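/- Let (Λ_Q, f) be a C^{1+Lip} expansive and transitive Markov system and assume moreover that each map g_i is real analytic on its domain. Then the Hausdorff dimension of Λ_Q is strictly less than 1. -/

import Mathlib

open Set Metric Filter MeasureTheory
open scoped Classical

/-- The word `[ω 0, ω 1, …, ω (n-1)]` read off from the sequence `ω`. -/
def wordOf {p : ℕ} (ω : ℕ → Fin p) (n : ℕ) : List (Fin p) :=
  (List.range n).map ω

/-- The cylinder sets `Δ_{i₁…iₙ} = g_{i₁…i_{n-1}}(I_{iₙ})` of the iterated function
system given by the big interval `I`, the subintervals `Isub i` and the maps `g i`;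
by convention `Δ_∅ = I`. -/
def cylOf {p : ℕ} (I : Set ℝ) (Isub : Fin p → Set ℝ) (g : Fin p → ℝ → ℝ) :
    List (Fin p) → Set ℝ
  | [] => I
  | [i] => Isub i
  | i :: j :: w => g i '' cylOf I Isub g (j :: w)

/-- The sequence `ω` contains the word `w` as a sub-word starting at position `n`. -/
def containsAt {p : ℕ} (ω : ℕ → Fin p) (w : List (Fin p)) (n : ℕ) : Prop :=
  ∀ k : ℕ, (hk : k < w.length) → ω (n + k) = w.get ⟨k, hk⟩

/-- The sequence `ω` belongs to `Σ_Q`, i.e. it contains no word of `Q` as a sub-word. -/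
def avoids {p : ℕ} (Q : Finset (List (Fin p))) (ω : ℕ → Fin p) : Prop :=
  ∀ w ∈ Q, ∀ n : ℕ, ¬ containsAt ω w n

/-- The limit set `Λ_Q = π(Σ_Q)`: points lying, for some `ω ∈ Σ_Q`, in all the
cylinders `Δ_{ω₀…ω_{n-1}}`. -/
def limitSetOf {p : ℕ} (I : Set ℝ) (Isub : Fin p → Set ℝ) (g : Fin p → ℝ → ℝ)
    (Q : Finset (List (Fin p))) : Set ℝ :=
  { x | ∃ ω : ℕ → Fin p, avoids Q ω ∧ ∀ n : ℕ, x ∈ cylOf I Isub g (wordOf ω n) }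

/-- `gIter g ω n = g_{i_n … i_1} = g_{ω (n-1)} ∘ ⋯ ∘ g_{ω 0}`. -/
def gIter {p : ℕ} (g : Fin p → ℝ → ℝ) (ω : ℕ → Fin p) : ℕ → ℝ → ℝ
  | 0 => id
  | n + 1 => g (ω n) ∘ gIter g ω n

/-- The derivative of the composition `gIter g ω n` at `x` (chain rule product). -/
noncomputable def gIterDer {p : ℕ} (g gder : Fin p → ℝ → ℝ) (ω : ℕ → Fin p)
    (n : ℕ) (x : ℝ) : ℝ :=
  ∏ k ∈ Finset.range n, gder (ω k) (gIter g ω k x)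

/-- Prepending the finite word `w` to the infinite sequence `ω`. -/
def prependWord {p : ℕ} (w : List (Fin p)) (ω : ℕ → Fin p) : ℕ → Fin p :=
  fun n => if h : n < w.length then w.get ⟨n, h⟩ else ω (n - w.length)

/-- `l(Σ_Q)`: the minimum, over all finite sets `Q'` of words with `Σ_{Q'} = Σ_Q`,
of the maximal length `l(Q')` of words of `Q'`. -/
noncomputable def minRepLen {p : ℕ} (Q : Finset (List (Fin p))) : ℕ :=
  sInf { n : ℕ | ∃ Q' : Finset (List (Fin p)),
    (∀ ω : ℕ → Fin p, avoids Q' ω ↔ avoids Q ω) ∧ Q'.sup List.length = n }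

/-- A `C^{1+Lip}` expansive and transitive Markov system `(Λ_Q, f)`. -/
structure ExpansiveMarkovSystem (p : ℕ) where
  /-- the alphabet is nonempty -/
  hp : 0 < p
  /-- the ambient closed interval `I` -/
  I : Set ℝ
  hI : ∃ a b : ℝ, a < b ∧ I = Set.Icc a b
  /-- the pairwise disjoint closed subintervals `I₁, …, I_p` -/
  Isub : Fin p → Set ℝ
  hIsub : ∀ i, ∃ a b : ℝ, a < b ∧ Isub i = Set.Icc a b
  hsubI : ∀ i, Isub i ⊆ I
  hdisj : ∀ i j, i ≠ j → Disjoint (Isub i) (Isub j)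
  /-- the contractions `g i`, defined on `⋃ j, Isub j` -/
  g : Fin p → ℝ → ℝ
  /-- the derivative of `g i` on `⋃ j, Isub j` -/
  gder : Fin p → ℝ → ℝ
  hg_inj : ∀ i, Set.InjOn (g i) (⋃ j, Isub j)
  hg_range : ∀ i, g i '' (⋃ j, Isub j) ⊆ interior (Isub i)
  hg_deriv : ∀ i, ∀ x ∈ ⋃ j, Isub j,
    HasDerivWithinAt (g i) (gder i x) (⋃ j, Isub j) x
  hgder_ne : ∀ i, ∀ x ∈ ⋃ j, Isub j, gder i x ≠ 0
  hgder_cont : ∀ i, ContinuousOn (gder i) (⋃ j, Isub j)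
  /-- `log |g i'|` is Lipschitz on the domain -/
  hgder_lip : ∀ i, ∃ θ : ℝ, ∀ x ∈ ⋃ j, Isub j, ∀ y ∈ ⋃ j, Isub j,
    abs (Real.log (abs (gder i x)) - Real.log (abs (gder i y))) ≤ θ * |x - y|
  /-- the expanding map `f`, with `f (g i x) = x` -/
  f : ℝ → ℝ
  /-- the derivative `f'` of `f` on the ranges of the `g i` -/
  fder : ℝ → ℝ
  hf : ∀ i, ∀ x ∈ ⋃ j, Isub j, f (g i x) = x
  hfder : ∀ i, ∀ x ∈ ⋃ j, Isub j, fder (g i x) = (gder i x)⁻¹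
  /-- the generator (expansivity) condition: `d_n → 0` -/
  hgen : ∀ ε : ℝ, 0 < ε → ∃ N : ℕ, ∀ w : List (Fin p), N ≤ w.length →
    Metric.diam (cylOf I Isub g w) < ε
  /-- the finite set of forbidden words -/
  Q : Finset (List (Fin p))
  /-- `Σ_Q` is completely invariant: `σ(Σ_Q) = Σ_Q` -/
  hQinv : ∀ ω : ℕ → Fin p, avoids Q ω →
    ∃ ω' : ℕ → Fin p, avoids Q ω' ∧ ∀ n : ℕ, ω' (n + 1) = ω n
  /-- `f|Λ_Q` is topologically transitive -/
  htrans : ∀ U V : Set ℝ, IsOpen U → IsOpen V →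
    (U ∩ limitSetOf I Isub g Q).Nonempty → (V ∩ limitSetOf I Isub g Q).Nonempty →
    ∃ n : ℕ, ∃ x ∈ U ∩ limitSetOf I Isub g Q, f^[n] x ∈ V

namespace ExpansiveMarkovSystem

variable {p : ℕ} (S : ExpansiveMarkovSystem p)

/-- The common domain `⋃ j, I_j` of the maps `g i`. -/
def dom : Set ℝ := ⋃ j, S.Isub j

/-- The cylinder `Δ_w` associated to the word `w`. -/
def cyl (w : List (Fin p)) : Set ℝ := cylOf S.I S.Isub S.g w

/-- The limit set `Λ_Q`. -/
def limitSet : Set ℝ := limitSetOf S.I S.Isub S.g S.Q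

/-- The domain of `f`, i.e. the union of the ranges of the `g i`. -/
def domF : Set ℝ := ⋃ i, S.g i '' S.dom

/-- The derivative `(fⁿ)'(x)` of the `n`-th iterate of `f` at `x`. -/
noncomputable def derIter (n : ℕ) (x : ℝ) : ℝ :=
  ∏ k ∈ Finset.range n, S.fder (S.f^[k] x)

/-- The Lyapunov exponent `χ(x) = limsup (1/n) log |(fⁿ)'(x)|`. -/
noncomputable def lyap (x : ℝ) : ℝ :=
  Filter.limsup (fun n : ℕ => Real.log |S.derIter n x| / n) Filter.atTop

/-- The set `H` of points of `Λ_Q` with infinitely many hyperbolic instants. -/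
def hypSet : Set ℝ :=
  { x ∈ S.limitSet | ∃ c₁ : ℝ, 0 < c₁ ∧ ∃ c₂ : ℝ, 0 < c₂ ∧
      ∃ n : ℕ → ℕ, StrictMono n ∧
        ∃ r : ℕ → ℝ, (∀ k, 0 < r k) ∧ Antitone r ∧
          Filter.Tendsto r Filter.atTop (nhds 0) ∧
          ∀ k : ℕ,
            (∀ y ∈ Metric.ball x (r k), ∀ j < n k, S.f^[j] y ∈ S.domF) ∧
            c₁ < Metric.diam (S.f^[n k] '' Metric.ball x (r k)) ∧
            (∀ y ∈ Metric.ball x (r k), ∀ z ∈ Metric.ball x (r k),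
              |S.derIter (n k) y| / |S.derIter (n k) z| < c₂) }

/-- `x` is a parabolic periodic point: `f^m(x) = x` and `|(f^m)'(x)| = 1`. -/
def IsParabolicPeriodic (x : ℝ) : Prop :=
  x ∈ S.limitSet ∧ ∃ m : ℕ, 1 ≤ m ∧ S.f^[m] x = x ∧ |S.derIter m x| = 1

/-- `ν` is a `t`-conformal (Borel probability) measure supported on `Λ_Q`. -/
def IsConformal (ν : Measure ℝ) (t : ℝ) : Prop :=
  IsProbabilityMeasure ν ∧ ν S.limitSetᶜ = 0 ∧
    ∀ A : Set ℝ, MeasurableSet A → A ⊆ S.limitSet → Set.InjOn S.f A →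
      ν (S.f '' A) = ∫⁻ x in A, ENNReal.ofReal (|S.fder x| ^ t) ∂ν

/-- `t_c = inf {t ≥ 0 : a t-conformal measure on Λ_Q exists}`. -/
noncomputable def tc : ℝ :=
  sInf { t : ℝ | 0 ≤ t ∧ ∃ ν : Measure ℝ, S.IsConformal ν t }

/-- `n` is a hyperbolic time for `x` with exponent `α`. -/
def IsHypTime (α : ℝ) (x : ℝ) (n : ℕ) : Prop :=
  ∀ k : ℕ, 1 ≤ k → k ≤ n → Real.exp (k * α) ≤ |S.derIter k (S.f^[n - k] x)|

/-- `H_HT(α)`: the points of `Λ_Q` with infinitely many hyperbolic times with exponent `α`. -/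
def HHT (α : ℝ) : Set ℝ :=
  { x ∈ S.limitSet | ∀ N : ℕ, ∃ n : ℕ, N ≤ n ∧ S.IsHypTime α x n }

end ExpansiveMarkovSystem

namespace ExpansiveMarkovSystem

variable {p : ℕ} (S : ExpansiveMarkovSystem p)

/-- The composition `g_{i₁} ∘ ⋯ ∘ g_{iₙ}` along a word. -/
def comp : List (Fin p) → ℝ → ℝ
  | [] => fun x => x
  | i :: w => fun x => S.g i (comp w x)

/-- The derivative of `S.comp w`. -/
def der : List (Fin p) → ℝ → ℝ
  | [] => fun _ => 1
  | i :: w => fun x => S.gder i (S.comp w x) * der w x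

@[simp] lemma comp_nil (x : ℝ) : S.comp [] x = x := rfl
@[simp] lemma comp_cons (i : Fin p) (w : List (Fin p)) (x : ℝ) :
    S.comp (i :: w) x = S.g i (S.comp w x) := rfl
@[simp] lemma der_nil (x : ℝ) : S.der [] x = 1 := rfl
@[simp] lemma der_cons (i : Fin p) (w : List (Fin p)) (x : ℝ) :
    S.der (i :: w) x = S.gder i (S.comp w x) * S.der w x := rfl

lemma comp_append (u v : List (Fin p)) (x : ℝ) :
    S.comp (u ++ v) x = S.comp u (S.comp v x) := by
  induction u with
  | nil => rfl
  | cons i u ih => simp [ih]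

lemma der_append (u v : List (Fin p)) (x : ℝ) :
    S.der (u ++ v) x = S.der u (S.comp v x) * S.der v x := by
  induction u with
  | nil => simp
  | cons i u ih => simp [ih, comp_append, mul_assoc]

lemma image_comp_append (u v : List (Fin p)) (X : Set ℝ) :
    S.comp (u ++ v) '' X = S.comp u '' (S.comp v '' X) := by
  rw [Set.image_image]; exact Set.image_congr fun x _ => S.comp_append u v x

lemma isub_subset_dom (i : Fin p) : S.Isub i ⊆ S.dom := subset_iUnion S.Isub i

lemma g_mem_interior (i : Fin p) {x : ℝ} (hx : x ∈ S.dom) :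
    S.g i x ∈ interior (S.Isub i) := S.hg_range i ⟨x, hx, rfl⟩

lemma g_mem_isub (i : Fin p) {x : ℝ} (hx : x ∈ S.dom) : S.g i x ∈ S.Isub i :=
  interior_subset (S.g_mem_interior i hx)

lemma comp_mem_dom (w : List (Fin p)) {x : ℝ} (hx : x ∈ S.dom) : S.comp w x ∈ S.dom := by
  induction w with
  | nil => exact hx
  | cons i w ih => exact S.isub_subset_dom i (S.g_mem_isub i ih)

lemma image_comp_subset_dom (w : List (Fin p)) {X : Set ℝ} (hX : X ⊆ S.dom) :
    S.comp w '' X ⊆ S.dom := by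
  rintro _ ⟨x, hx, rfl⟩; exact S.comp_mem_dom w (hX hx)

lemma comp_injOn (w : List (Fin p)) : InjOn (S.comp w) S.dom := by
  induction w with
  | nil => exact fun x _ y _ h => h
  | cons i w ih =>
    intro x hx y hy h
    exact ih hx hy (S.hg_inj i (S.comp_mem_dom w hx) (S.comp_mem_dom w hy) h)

lemma comp_hasDerivWithinAt (w : List (Fin p)) {x : ℝ} (hx : x ∈ S.dom) :
    HasDerivWithinAt (S.comp w) (S.der w x) S.dom x := by
  induction w with
  | nil => exact hasDerivWithinAt_id x _
  | cons i w ih =>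
    exact (S.hg_deriv i _ (S.comp_mem_dom w hx)).comp x ih
      (fun y hy => S.comp_mem_dom w hy)

lemma comp_continuousOn (w : List (Fin p)) : ContinuousOn (S.comp w) S.dom :=
  fun _ hx => (S.comp_hasDerivWithinAt w hx).continuousWithinAt

lemma der_ne_zero (w : List (Fin p)) {x : ℝ} (hx : x ∈ S.dom) : S.der w x ≠ 0 := by
  induction w with
  | nil => simp
  | cons i w ih => exact mul_ne_zero (S.hgder_ne i _ (S.comp_mem_dom w hx)) ih

lemma abs_der_pos (w : List (Fin p)) {x : ℝ} (hx : x ∈ S.dom) : 0 < |S.der w x| :=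
  abs_pos.2 (S.der_ne_zero w hx)

lemma der_continuousOn (w : List (Fin p)) : ContinuousOn (S.der w) S.dom := by
  induction w with
  | nil => exact continuousOn_const
  | cons i w ih =>
    exact ((S.hgder_cont i).comp (S.comp_continuousOn w) (fun y hy => S.comp_mem_dom w hy)).mul ih

lemma cyl_cons (i : Fin p) {w : List (Fin p)} (hw : w ≠ []) :
    S.cyl (i :: w) = S.g i '' S.cyl w := by
  cases w with
  | nil => exact absurd rfl hw
  | cons j w => rfl

lemma cyl_append (w : List (Fin p)) {v : List (Fin p)} (hv : v ≠ []) :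
    S.cyl (w ++ v) = S.comp w '' S.cyl v := by
  induction w with
  | nil => exact (image_id' _).symm
  | cons i w ih =>
    rw [List.cons_append, S.cyl_cons i (by simp [hv]), ih, Set.image_image]; rfl

lemma cyl_cons_subset_isub (i : Fin p) (w : List (Fin p)) : S.cyl (i :: w) ⊆ S.Isub i := by
  induction w generalizing i with
  | nil => exact subset_rfl
  | cons j w ih =>
    rw [S.cyl_cons i (by simp)]
    rintro _ ⟨x, hx, rfl⟩
    exact S.g_mem_isub i (S.isub_subset_dom j (ih j hx))

lemma cyl_subset_dom {w : List (Fin p)} (hw : w ≠ []) : S.cyl w ⊆ S.dom := by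
  cases w with
  | nil => exact absurd rfl hw
  | cons i w => exact (S.cyl_cons_subset_isub i w).trans (S.isub_subset_dom i)

lemma cyl_subset_I (w : List (Fin p)) : S.cyl w ⊆ S.I := by
  cases w with
  | nil => exact subset_rfl
  | cons i w => exact (S.cyl_cons_subset_isub i w).trans (S.hsubI i)

lemma cyl_append_subset (w v : List (Fin p)) : S.cyl (w ++ v) ⊆ S.cyl w := by
  induction w with
  | nil => exact S.cyl_subset_I v
  | cons i w ih =>
    rcases eq_or_ne w [] with rfl | hw
    · exact S.cyl_cons_subset_isub i v
    · rw [List.cons_append, S.cyl_cons i (by simp [hw]), S.cyl_cons i hw]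
      exact image_mono ih

lemma cyl_anti {u v : List (Fin p)} (h : u <+: v) : S.cyl v ⊆ S.cyl u := by
  obtain ⟨t, rfl⟩ := h; exact S.cyl_append_subset u t

lemma prefix_or_prefix_of_cyl_inter {u v : List (Fin p)}
    (h : (S.cyl u ∩ S.cyl v).Nonempty) : u <+: v ∨ v <+: u := by
  induction u generalizing v with
  | nil => left; exact List.nil_prefix
  | cons i u ih =>
    cases v with
    | nil => right; exact List.nil_prefix
    | cons j v =>
      obtain ⟨x, hx, hy⟩ := h
      have hij : i = j := by
        by_contra hne
        exact (Set.disjoint_left.1 (S.hdisj i j hne)) (S.cyl_cons_subset_isub i u hx)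
          (S.cyl_cons_subset_isub j v hy)
      subst hij
      rcases eq_or_ne u [] with rfl | hu
      · left; simp
      rcases eq_or_ne v [] with rfl | hv
      · right; simp
      rw [S.cyl_cons i hu] at hx
      rw [S.cyl_cons i hv] at hy
      obtain ⟨a, ha, rfl⟩ := hx
      obtain ⟨b, hb, hab⟩ := hy
      have : b = a := S.hg_inj i (S.cyl_subset_dom hv hb) (S.cyl_subset_dom hu ha) hab
      subst this
      rcases ih ⟨b, ha, hb⟩ with h | h
      · left; simpa using h
      · right; simpa using h

lemma cyl_eq_Icc (w : List (Fin p)) : ∃ a b : ℝ, a < b ∧ S.cyl w = Icc a b := by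
  induction w with
  | nil => exact S.hI
  | cons i w ih =>
    rcases eq_or_ne w [] with rfl | hw
    · exact S.hIsub i
    obtain ⟨a, b, hab, h⟩ := ih
    rw [S.cyl_cons i hw]
    have hd : Icc a b ⊆ S.dom := h ▸ S.cyl_subset_dom hw
    have hc : ContinuousOn (S.g i) (Icc a b) :=
      fun x hx => ((S.hg_deriv i x (hd hx)).continuousWithinAt).mono hd
    have := hc.image_Icc hab.le
    rw [h, this]
    refine ⟨_, _, ?_, rfl⟩
    have ha : S.g i a ∈ S.g i '' Icc a b := ⟨a, left_mem_Icc.2 hab.le, rfl⟩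
    have hb : S.g i b ∈ S.g i '' Icc a b := ⟨b, right_mem_Icc.2 hab.le, rfl⟩
    have hne : S.g i a ≠ S.g i b := fun e =>
      hab.ne (S.hg_inj i (hd (left_mem_Icc.2 hab.le)) (hd (right_mem_Icc.2 hab.le)) e)
    rw [this] at ha hb
    by_contra hcon
    push Not at hcon
    apply hne
    have h1 := ha.1; have h2 := ha.2; have h3 := hb.1; have h4 := hb.2
    linarith

lemma isCompact_cyl (w : List (Fin p)) : IsCompact (S.cyl w) := by
  obtain ⟨a, b, -, h⟩ := S.cyl_eq_Icc w; rw [h]; exact isCompact_Icc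

lemma measurableSet_cyl (w : List (Fin p)) : MeasurableSet (S.cyl w) :=
  (S.isCompact_cyl w).isClosed.measurableSet

lemma isPreconnected_cyl (w : List (Fin p)) : IsPreconnected (S.cyl w) := by
  obtain ⟨a, b, -, h⟩ := S.cyl_eq_Icc w; rw [h]; exact isPreconnected_Icc

lemma cyl_nonempty (w : List (Fin p)) : (S.cyl w).Nonempty := by
  obtain ⟨a, b, hab, h⟩ := S.cyl_eq_Icc w; rw [h]; exact nonempty_Icc.2 hab.le

lemma volume_cyl_pos (w : List (Fin p)) : 0 < volume.real (S.cyl w) := by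
  obtain ⟨a, b, hab, h⟩ := S.cyl_eq_Icc w
  rw [h, Real.volume_real_Icc_of_le hab.le]; linarith

lemma diam_cyl (w : List (Fin p)) : Metric.diam (S.cyl w) = volume.real (S.cyl w) := by
  obtain ⟨a, b, hab, h⟩ := S.cyl_eq_Icc w
  rw [h, Real.volume_real_Icc_of_le hab.le, Real.diam_Icc hab.le]

lemma isCompact_I : IsCompact S.I := S.isCompact_cyl []

lemma volume_ne_top {X : Set ℝ} (hX : X ⊆ S.I) : volume X ≠ ⊤ :=
  ((measure_mono hX).trans_lt S.isCompact_I.measure_lt_top).ne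

lemma dom_subset_I : S.dom ⊆ S.I := iUnion_subset S.hsubI

lemma isCompact_dom : IsCompact S.dom := isCompact_iUnion fun i => S.isCompact_cyl [i]

lemma volume_image_comp (w : List (Fin p)) {E : Set ℝ} (hE : MeasurableSet E)
    (hd : E ⊆ S.dom) :
    volume (S.comp w '' E) = ∫⁻ x in E, ENNReal.ofReal |S.der w x| := by
  have := lintegral_image_eq_lintegral_abs_deriv_mul hE
    (fun x hx => (S.comp_hasDerivWithinAt w (hd hx)).mono hd) ((S.comp_injOn w).mono hd)
    (fun _ => 1)
  simpa using this

lemma measurableSet_image_comp (w : List (Fin p)) {E : Set ℝ} (hE : MeasurableSet E)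
    (hd : E ⊆ S.dom) : MeasurableSet (S.comp w '' E) :=
  hE.image_of_continuousOn_injOn ((S.comp_continuousOn w).mono hd) ((S.comp_injOn w).mono hd)

lemma mem_nhds_image_comp (w : List (Fin p)) {x : ℝ} {U : Set ℝ} (hx : x ∈ interior S.dom)
    (hU : U ∈ nhds x) : S.comp w '' U ∈ nhds (S.comp w x) := by
  have hK : ∀ y ∈ interior S.dom, HasDerivAt (S.comp w) (S.der w y) y := fun y hy =>
    (S.comp_hasDerivWithinAt w (interior_subset hy)).hasDerivAt (mem_interior_iff_mem_nhds.1 hy)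
  have hs : HasStrictDerivAt (S.comp w) (S.der w x) x := by
    refine hasStrictDerivAt_of_hasDerivAt_of_continuousAt
      (f' := S.der w) ?_ ?_
    · filter_upwards [isOpen_interior.mem_nhds hx] with y hy using hK y hy
    · exact (S.der_continuousOn w).continuousAt (mem_interior_iff_mem_nhds.1 hx)
  rw [← hs.map_nhds_eq (S.der_ne_zero w (interior_subset hx))]
  exact image_mem_map hU

lemma cyl_mem_nhds {w : List (Fin p)} (hw : w ≠ []) {i : Fin p} {v : List (Fin p)} {z : ℝ}
    (hz : z ∈ S.cyl (w ++ i :: v)) : S.cyl w ∈ nhds z := by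
  induction w generalizing z with
  | nil => exact absurd rfl hw
  | cons j w ih =>
    rw [List.cons_append, S.cyl_cons j (by simp)] at hz
    obtain ⟨y, hy, rfl⟩ := hz
    rcases eq_or_ne w [] with rfl | hw'
    · exact mem_interior_iff_mem_nhds.1 (S.g_mem_interior j (S.cyl_subset_dom (by simp) hy))
    · rw [S.cyl_cons j hw']
      have h1 := ih hw' hy
      exact S.mem_nhds_image_comp [j]
        (mem_interior_iff_mem_nhds.2 (mem_of_superset h1 (S.cyl_subset_dom hw'))) h1

end ExpansiveMarkovSystem

/-- Prepending a letter to a sequence. -/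
def seqCons {α : Type*} (i : α) (ω : ℕ → α) : ℕ → α
  | 0 => i
  | n + 1 => ω n

/-- Prepending a finite word to a sequence. -/
def seqAppend {α : Type*} : List α → (ℕ → α) → ℕ → α
  | [], ω => ω
  | i :: w, ω => seqCons i (seqAppend w ω)

/-- The sequence with the first `k` letters removed. -/
def seqDrop {α : Type*} (k : ℕ) (ω : ℕ → α) : ℕ → α := fun n => ω (n + k)

section Words

variable {p : ℕ}

@[simp] lemma length_wordOf (ω : ℕ → Fin p) (n : ℕ) : (wordOf ω n).length = n := by
  simp [wordOf]

@[simp] lemma wordOf_zero (ω : ℕ → Fin p) : wordOf ω 0 = [] := rfl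

lemma wordOf_succ (ω : ℕ → Fin p) (n : ℕ) : wordOf ω (n + 1) = wordOf ω n ++ [ω n] := by
  simp [wordOf, List.range_succ]

lemma wordOf_ne_nil (ω : ℕ → Fin p) {n : ℕ} (hn : n ≠ 0) : wordOf ω n ≠ [] := by
  intro h; apply hn; simpa using congrArg List.length h

lemma getElem_wordOf (ω : ℕ → Fin p) (n i : ℕ) (h : i < (wordOf ω n).length) :
    (wordOf ω n)[i] = ω i := by simp [wordOf]

lemma wordOf_add (ω : ℕ → Fin p) (m n : ℕ) :
    wordOf ω (m + n) = wordOf ω m ++ wordOf (seqDrop m ω) n := by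
  induction n with
  | zero => simp
  | succ n ih => rw [← add_assoc, wordOf_succ, ih, wordOf_succ]; simp [seqDrop, add_comm]

lemma wordOf_prefix_wordOf (ω : ℕ → Fin p) {m n : ℕ} (h : m ≤ n) : wordOf ω m <+: wordOf ω n := by
  obtain ⟨k, rfl⟩ := Nat.exists_eq_add_of_le h
  rw [wordOf_add]; exact List.prefix_append _ _

lemma eq_wordOf_of_prefix_wordOf {ω : ℕ → Fin p} {n : ℕ} {u : List (Fin p)} (h : u <+: wordOf ω n) :
    u = wordOf ω u.length := by
  have hl : u.length ≤ n := by simpa using h.length_le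
  have h2 := wordOf_prefix_wordOf ω hl
  exact (List.prefix_of_prefix_length_le h h2 (by simp)).eq_of_length (by simp)

lemma wordOf_seqCons (i : Fin p) (ω : ℕ → Fin p) (n : ℕ) :
    wordOf (seqCons i ω) (n + 1) = i :: wordOf ω n := by
  induction n with
  | zero => rfl
  | succ n ih => rw [wordOf_succ, ih, wordOf_succ]; rfl

lemma wordOf_seqAppend (w : List (Fin p)) (ω : ℕ → Fin p) (n : ℕ) :
    wordOf (seqAppend w ω) (w.length + n) = w ++ wordOf ω n := by
  induction w with
  | nil => simp [seqAppend]
  | cons i w ih =>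
    rw [List.length_cons, show w.length + 1 + n = w.length + n + 1 by ring, seqAppend,
      wordOf_seqCons, ih]; rfl

lemma wordOf_seqAppend_length (w : List (Fin p)) (ω : ℕ → Fin p) :
    wordOf (seqAppend w ω) w.length = w := by
  simpa using wordOf_seqAppend w ω 0

lemma seqDrop_add {α : Type*} (m n : ℕ) (ω : ℕ → α) :
    seqDrop (m + n) ω = seqDrop m (seqDrop n ω) := by
  funext k; simp [seqDrop, add_assoc]

lemma seqDrop_seqAppend {α : Type*} (w : List α) (ω : ℕ → α) :
    seqDrop w.length (seqAppend w ω) = ω := by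
  induction w with
  | nil => rfl
  | cons i w ih =>
    rw [List.length_cons, seqDrop_add]
    exact ih

lemma seq_ext_wordOf {ω ζ : ℕ → Fin p} (h : ∀ n, wordOf ω n = wordOf ζ n) : ω = ζ := by
  funext n
  have h1 := h (n + 1)
  have h2 : n < (wordOf ω (n + 1)).length := by simp
  rw [← getElem_wordOf ω (n + 1) n h2, ← getElem_wordOf ζ (n + 1) n (by simp)]
  simp [h1]

lemma wordOf_eq_iff {ω ζ : ℕ → Fin p} {n : ℕ} :
    wordOf ω n = wordOf ζ n ↔ ∀ i < n, ω i = ζ i := by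
  constructor
  · intro h i hi
    rw [← getElem_wordOf ω n i (by simpa), ← getElem_wordOf ζ n i (by simpa)]
    simp [h]
  · intro h
    apply List.ext_getElem (by simp)
    intro i h1 h2
    rw [getElem_wordOf, getElem_wordOf]
    exact h i (by simpa using h1)

lemma seqAppend_wordOf (ω : ℕ → Fin p) (n : ℕ) :
    seqAppend (wordOf ω n) (seqDrop n ω) = ω := by
  apply seq_ext_wordOf
  intro k
  have : wordOf (seqAppend (wordOf ω n) (seqDrop n ω)) (n + k) = wordOf ω (n + k) := by
    have := wordOf_seqAppend (wordOf ω n) (seqDrop n ω) k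
    rw [length_wordOf] at this
    rw [this, wordOf_add]
  rw [wordOf_eq_iff] at this ⊢
  exact fun i hi => this i (by omega)

lemma wordOf_eq_of_le {ω ζ : ℕ → Fin p} {m n : ℕ} (hmn : m ≤ n)
    (h : wordOf ω n = wordOf ζ n) : wordOf ω m = wordOf ζ m := by
  rw [wordOf_eq_iff] at h ⊢
  exact fun i hi => h i (by omega)

end Words

namespace ExpansiveMarkovSystem

variable {p : ℕ} (S : ExpansiveMarkovSystem p)

lemma exists_common_lip : ∃ θ : ℝ, 0 ≤ θ ∧ ∀ i, ∀ x ∈ S.dom, ∀ y ∈ S.dom,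
    abs (Real.log |S.gder i x| - Real.log |S.gder i y|) ≤ θ * |x - y| := by
  choose θ hθ using S.hgder_lip
  refine ⟨∑ i, |θ i|, Finset.sum_nonneg fun i _ => abs_nonneg _, fun i x hx y hy => ?_⟩
  refine (hθ i x hx y hy).trans (mul_le_mul_of_nonneg_right ?_ (abs_nonneg _))
  exact (le_abs_self _).trans
    (Finset.single_le_sum (f := fun i => |θ i|) (fun i _ => abs_nonneg _) (Finset.mem_univ i))

/-- A common Lipschitz constant of the functions `log |g_i'|`. -/
noncomputable def lip : ℝ := S.exists_common_lip.choose

lemma lip_nonneg : 0 ≤ S.lip := S.exists_common_lip.choose_spec.1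

lemma lip_spec (i : Fin p) {x y : ℝ} (hx : x ∈ S.dom) (hy : y ∈ S.dom) :
    abs (Real.log |S.gder i x| - Real.log |S.gder i y|) ≤ S.lip * |x - y| :=
  S.exists_common_lip.choose_spec.2 i x hx y hy

/-- The total length of the images of `J` under the proper suffixes of the word. -/
noncomputable def sumLen (J : Set ℝ) : List (Fin p) → ℝ
  | [] => 0
  | _ :: w => volume.real (S.comp w '' J) + sumLen J w

@[simp] lemma sumLen_nil (J : Set ℝ) : S.sumLen J [] = 0 := rfl
@[simp] lemma sumLen_cons (J : Set ℝ) (i : Fin p) (w : List (Fin p)) :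
    S.sumLen J (i :: w) = volume.real (S.comp w '' J) + S.sumLen J w := rfl

lemma sumLen_nonneg (J : Set ℝ) (w : List (Fin p)) : 0 ≤ S.sumLen J w := by
  induction w with
  | nil => simp
  | cons i w ih => simp only [sumLen_cons]; positivity

lemma sumLen_append (J : Set ℝ) (u v : List (Fin p)) :
    S.sumLen J (u ++ v) = S.sumLen (S.comp v '' J) u + S.sumLen J v := by
  induction u with
  | nil => simp
  | cons i u ih => simp only [List.cons_append, sumLen_cons, ih, image_comp_append]; ring

lemma sumLen_mono {J J' : Set ℝ} (h : J ⊆ J') (hd : J' ⊆ S.dom) (w : List (Fin p)) :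
    S.sumLen J w ≤ S.sumLen J' w := by
  induction w with
  | nil => simp
  | cons i w ih =>
    simp only [sumLen_cons]
    have : volume.real (S.comp w '' J) ≤ volume.real (S.comp w '' J') :=
      measureReal_mono (image_mono h)
        (S.volume_ne_top ((S.image_comp_subset_dom w hd).trans S.dom_subset_I))
    linarith

lemma abs_sub_le_volume {J : Set ℝ} (hc : IsPreconnected J) (hI : J ⊆ S.I) {x y : ℝ}
    (hx : x ∈ J) (hy : y ∈ J) : |x - y| ≤ volume.real J := by
  have h1 : uIcc x y ⊆ J := hc.ordConnected.uIcc_subset hx hy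
  have h2 := measureReal_mono h1 (S.volume_ne_top hI)
  rw [measureReal_def, Real.volume_interval, ENNReal.toReal_ofReal (abs_nonneg _),
    abs_sub_comm] at h2
  exact h2

lemma isPreconnected_image_comp (w : List (Fin p)) {J : Set ℝ} (hc : IsPreconnected J)
    (hd : J ⊆ S.dom) : IsPreconnected (S.comp w '' J) :=
  hc.image _ ((S.comp_continuousOn w).mono hd)

lemma abs_log_der_sub_le (w : List (Fin p)) {J : Set ℝ} (hc : IsPreconnected J)
    (hd : J ⊆ S.dom) {x y : ℝ} (hx : x ∈ J) (hy : y ∈ J) :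
    abs (Real.log |S.der w x| - Real.log |S.der w y|) ≤ S.lip * S.sumLen J w := by
  induction w with
  | nil => simp
  | cons i w ih =>
    have hx' := S.comp_mem_dom w (hd hx)
    have hy' := S.comp_mem_dom w (hd hy)
    simp only [der_cons, abs_mul, sumLen_cons]
    rw [Real.log_mul (abs_ne_zero.2 (S.hgder_ne i _ hx')) (S.abs_der_pos w (hd hx)).ne',
      Real.log_mul (abs_ne_zero.2 (S.hgder_ne i _ hy')) (S.abs_der_pos w (hd hy)).ne']
    have h1 := S.lip_spec i hx' hy'
    have h2 := S.abs_sub_le_volume (S.isPreconnected_image_comp w hc hd)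
      ((S.image_comp_subset_dom w hd).trans S.dom_subset_I)
      (mem_image_of_mem _ hx) (mem_image_of_mem _ hy)
    have h3 := mul_le_mul_of_nonneg_left h2 S.lip_nonneg
    rw [abs_le] at h1 ih ⊢
    constructor <;> nlinarith [h1.1, h1.2, ih.1, ih.2]

lemma abs_der_le_exp_mul (w : List (Fin p)) {J : Set ℝ} (hc : IsPreconnected J)
    (hd : J ⊆ S.dom) {x y : ℝ} (hx : x ∈ J) (hy : y ∈ J) :
    |S.der w x| ≤ Real.exp (S.lip * S.sumLen J w) * |S.der w y| := by
  have h := S.abs_log_der_sub_le w hc hd hx hy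
  have hx' := S.abs_der_pos w (hd hx)
  have hy' := S.abs_der_pos w (hd hy)
  rw [← Real.log_le_log_iff hx' (by positivity), Real.log_mul (Real.exp_pos _).ne' hy'.ne',
    Real.log_exp]
  have := (abs_le.1 h).2
  linarith

lemma volume_image_le (w : List (Fin p)) {E : Set ℝ} (hE : MeasurableSet E) (hd : E ⊆ S.dom)
    {c : ℝ} (hc : ∀ x ∈ E, |S.der w x| ≤ c) :
    volume.real (S.comp w '' E) ≤ c * volume.real E := by
  rcases E.eq_empty_or_nonempty with rfl | ⟨x0, hx0⟩
  · simp
  have hc0 : 0 ≤ c := (abs_nonneg _).trans (hc x0 hx0)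
  have hfin : volume E ≠ ⊤ := S.volume_ne_top (hd.trans S.dom_subset_I)
  have : volume (S.comp w '' E) ≤ ENNReal.ofReal c * volume E := by
    rw [S.volume_image_comp w hE hd, ← setLIntegral_const]
    exact setLIntegral_mono' hE fun x hx => ENNReal.ofReal_le_ofReal (hc x hx)
  have h2 := ENNReal.toReal_mono (ENNReal.mul_ne_top ENNReal.ofReal_ne_top hfin) this
  rwa [ENNReal.toReal_mul, ENNReal.toReal_ofReal hc0] at h2

lemma le_volume_image (w : List (Fin p)) {E : Set ℝ} (hE : MeasurableSet E) (hd : E ⊆ S.dom)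
    {c : ℝ} (hc0 : 0 ≤ c) (hc : ∀ x ∈ E, c ≤ |S.der w x|) :
    c * volume.real E ≤ volume.real (S.comp w '' E) := by
  have hfin : volume (S.comp w '' E) ≠ ⊤ :=
    S.volume_ne_top ((S.image_comp_subset_dom w hd).trans S.dom_subset_I)
  have : ENNReal.ofReal c * volume E ≤ volume (S.comp w '' E) := by
    rw [S.volume_image_comp w hE hd, ← setLIntegral_const]
    exact setLIntegral_mono' hE fun x hx => ENNReal.ofReal_le_ofReal (hc x hx)
  have h2 := ENNReal.toReal_mono hfin this
  rwa [ENNReal.toReal_mul, ENNReal.toReal_ofReal hc0] at h2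

lemma abs_der_mul_volume_le (w : List (Fin p)) {J : Set ℝ} (hc : IsPreconnected J)
    (hd : J ⊆ S.dom) {x : ℝ} (hx : x ∈ J) {F : Set ℝ} (hF : MeasurableSet F)
    (hFJ : F ⊆ J) :
    |S.der w x| * volume.real F ≤
      Real.exp (S.lip * S.sumLen J w) * volume.real (S.comp w '' F) := by
  have h := S.le_volume_image w hF (hFJ.trans hd)
    (c := |S.der w x| / Real.exp (S.lip * S.sumLen J w)) (by positivity) (fun y hy => by
      rw [div_le_iff₀' (Real.exp_pos _)]
      exact S.abs_der_le_exp_mul w hc hd hx (hFJ hy))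
  rw [div_mul_eq_mul_div, div_le_iff₀' (Real.exp_pos _)] at h
  exact h

lemma volume_le_abs_der_mul (w : List (Fin p)) {J : Set ℝ} (hc : IsPreconnected J)
    (hd : J ⊆ S.dom) {x : ℝ} (hx : x ∈ J) {F : Set ℝ} (hF : MeasurableSet F)
    (hFJ : F ⊆ J) :
    volume.real (S.comp w '' F) ≤
      Real.exp (S.lip * S.sumLen J w) * |S.der w x| * volume.real F :=
  S.volume_image_le w hF (hFJ.trans hd) fun _ hy => S.abs_der_le_exp_mul w hc hd (hFJ hy) hx

lemma volume_image_mul_le (w : List (Fin p)) {J : Set ℝ} (hc : IsPreconnected J)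
    (hd : J ⊆ S.dom) {E F : Set ℝ} (hE : MeasurableSet E) (hEJ : E ⊆ J)
    (hF : MeasurableSet F) (hFJ : F ⊆ J) :
    volume.real (S.comp w '' E) * volume.real F ≤
      Real.exp (S.lip * S.sumLen J w) * volume.real (S.comp w '' F) * volume.real E := by
  rcases eq_or_lt_of_le (measureReal_nonneg (μ := volume) (s := F)) with h0 | h0
  · rw [← h0, mul_zero]; positivity
  have h := S.volume_image_le w hE (hEJ.trans hd)
    (c := Real.exp (S.lip * S.sumLen J w) * volume.real (S.comp w '' F) / volume.real F)
    (fun y hy => by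
      rw [le_div_iff₀ h0]
      exact S.abs_der_mul_volume_le w hc hd (hEJ hy) hF hFJ)
  rw [div_mul_eq_mul_div, le_div_iff₀ h0] at h
  exact h

lemma volume_sub_mul_le (w : List (Fin p)) {J : Set ℝ} (hc : IsPreconnected J)
    (hd : J ⊆ S.dom) {X D : Set ℝ} (hX : MeasurableSet X) (hXD : X ⊆ D)
    (hD : MeasurableSet D) (hDJ : D ⊆ J) :
    (volume.real D - volume.real X) * volume.real (S.comp w '' D) ≤
      Real.exp (S.lip * S.sumLen J w) *
        (volume.real (S.comp w '' D) - volume.real (S.comp w '' X)) * volume.real D := by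
  have h := S.volume_image_mul_le w hc hd hD hDJ (hD.diff hX) (sdiff_subset.trans hDJ)
  have hinj : S.comp w '' (D \ X) = S.comp w '' D \ S.comp w '' X :=
    ((S.comp_injOn w).mono (hDJ.trans hd)).image_sdiff_subset hXD
  rw [hinj] at h
  have e1 : volume.real (D \ X) = volume.real D - volume.real X :=
    measureReal_sdiff hXD hX (S.volume_ne_top (hDJ.trans (hd.trans S.dom_subset_I)))
  have e2 : volume.real (S.comp w '' D \ S.comp w '' X) =
      volume.real (S.comp w '' D) - volume.real (S.comp w '' X) :=
    measureReal_sdiff (image_mono hXD)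
      (S.measurableSet_image_comp w hX ((hXD.trans hDJ).trans hd))
      (S.volume_ne_top ((S.image_comp_subset_dom w (hDJ.trans hd)).trans
        S.dom_subset_I))
  rw [e1, e2] at h
  linarith

lemma exists_volume_cyl_lt {ε : ℝ} (hε : 0 < ε) :
    ∃ N : ℕ, ∀ w : List (Fin p), N ≤ w.length → volume.real (S.cyl w) < ε := by
  obtain ⟨N, hN⟩ := S.hgen ε hε
  exact ⟨N, fun w hw => by rw [← S.diam_cyl]; exact hN w hw⟩

lemma abs_sub_le_volume_cyl {w : List (Fin p)} {x y : ℝ} (hx : x ∈ S.cyl w) (hy : y ∈ S.cyl w) :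
    |x - y| ≤ volume.real (S.cyl w) :=
  S.abs_sub_le_volume (S.isPreconnected_cyl w) (S.cyl_subset_I w) hx hy

lemma volume_cyl_anti {u v : List (Fin p)} (h : u <+: v) :
    volume.real (S.cyl v) ≤ volume.real (S.cyl u) :=
  measureReal_mono (S.cyl_anti h) (S.volume_ne_top (S.cyl_subset_I u))

lemma iInter_cyl_nonempty (ω : ℕ → Fin p) : (⋂ n, S.cyl (wordOf ω n)).Nonempty :=
  IsCompact.nonempty_iInter_of_sequence_nonempty_isCompact_isClosed _
    (fun n => S.cyl_anti (wordOf_prefix_wordOf ω n.le_succ)) (fun _ => S.cyl_nonempty _)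
    (S.isCompact_cyl _) (fun _ => (S.isCompact_cyl _).isClosed)

/-- The coding map `π`. -/
noncomputable def pt (ω : ℕ → Fin p) : ℝ := (S.iInter_cyl_nonempty ω).choose

lemma pt_mem (ω : ℕ → Fin p) (n : ℕ) : S.pt ω ∈ S.cyl (wordOf ω n) :=
  mem_iInter.1 (S.iInter_cyl_nonempty ω).choose_spec n

lemma eq_pt {ω : ℕ → Fin p} {x : ℝ} (N : ℕ) (h : ∀ n ≥ N, x ∈ S.cyl (wordOf ω n)) :
    x = S.pt ω := by
  by_contra hne
  obtain ⟨M, hM⟩ := S.exists_volume_cyl_lt (abs_pos.2 (sub_ne_zero.2 hne))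
  have h1 := S.abs_sub_le_volume_cyl (h (max N M) (le_max_left _ _)) (S.pt_mem ω (max N M))
  exact absurd (hM (wordOf ω (max N M)) (by simp)) (not_lt.2 h1)

lemma pt_mem_dom (ω : ℕ → Fin p) : S.pt ω ∈ S.dom :=
  S.cyl_subset_dom (wordOf_ne_nil ω one_ne_zero) (S.pt_mem ω 1)

lemma limitSet_subset_range_pt : S.limitSet ⊆ range S.pt := by
  rintro x ⟨ω, -, h⟩
  exact ⟨ω, (S.eq_pt 0 fun n _ => h n).symm⟩

lemma comp_pt (w : List (Fin p)) (ω : ℕ → Fin p) :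
    S.comp w (S.pt ω) = S.pt (seqAppend w ω) := by
  apply S.eq_pt (w.length + 1)
  intro n hn
  obtain ⟨k, rfl⟩ := Nat.exists_eq_add_of_le hn
  rw [add_assoc, wordOf_seqAppend, S.cyl_append w (wordOf_ne_nil ω (by omega))]
  exact mem_image_of_mem _ (S.pt_mem ω _)

lemma wordOf_eq_of_pt_mem {ω : ℕ → Fin p} {w : List (Fin p)} (h : S.pt ω ∈ S.cyl w) :
    wordOf ω w.length = w := by
  rcases S.prefix_or_prefix_of_cyl_inter ⟨_, S.pt_mem ω w.length, h⟩ with h | h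
  · exact h.eq_of_length (by simp)
  · exact (h.eq_of_length (by simp)).symm

lemma pt_injective : Function.Injective S.pt := by
  intro ω ζ h
  apply seq_ext_wordOf
  intro n
  have h1 : S.pt ζ ∈ S.cyl (wordOf ω n) := h ▸ S.pt_mem ω n
  have := S.wordOf_eq_of_pt_mem h1
  rw [length_wordOf] at this
  exact this.symm

lemma cyl_wordOf_mem_nhds (ω : ℕ → Fin p) {n : ℕ} (hn : n ≠ 0) :
    S.cyl (wordOf ω n) ∈ nhds (S.pt ω) := by
  have := S.pt_mem ω (n + 1)
  rw [wordOf_succ] at this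
  exact S.cyl_mem_nhds (wordOf_ne_nil ω hn) this

lemma pt_mem_interior_dom (ω : ℕ → Fin p) : S.pt ω ∈ interior S.dom :=
  mem_interior_iff_mem_nhds.2 (mem_of_superset (S.cyl_wordOf_mem_nhds ω one_ne_zero)
    (S.cyl_subset_dom (wordOf_ne_nil ω one_ne_zero)))

/-- The gaps of the cylinder of `v`. -/
def gap (v : List (Fin p)) : Set ℝ := S.cyl v \ ⋃ a, S.cyl (v ++ [a])

lemma gap_subset (v : List (Fin p)) : S.gap v ⊆ S.cyl v := sdiff_subset

lemma measurableSet_gap (v : List (Fin p)) : MeasurableSet (S.gap v) :=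
  (S.measurableSet_cyl v).diff (MeasurableSet.iUnion fun _ => S.measurableSet_cyl _)

lemma volume_gap_pos {v : List (Fin p)} (hv : v ≠ []) : 0 < volume.real (S.gap v) := by
  obtain ⟨a, b, hab, h⟩ := S.cyl_eq_Icc v
  have hcl : IsClosed (⋃ i, S.cyl (v ++ [i])) :=
    isClosed_iUnion_of_finite fun i => (S.isCompact_cyl _).isClosed
  have ha : a ∈ (⋃ i, S.cyl (v ++ [i]))ᶜ := by
    intro hmem
    obtain ⟨i, hi⟩ := mem_iUnion.1 hmem
    have := S.cyl_mem_nhds hv hi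
    rw [h, Icc_mem_nhds_iff] at this
    exact lt_irrefl _ this.1
  obtain ⟨ε, hε, hball⟩ := Metric.isOpen_iff.1 hcl.isOpen_compl a ha
  have hsub : Icc a (min b (a + ε / 2)) ⊆ S.gap v := by
    intro x hx
    have h1 := hx.1
    have h2 := hx.2.trans (min_le_left _ _)
    have h3 := hx.2.trans (min_le_right _ _)
    refine ⟨h ▸ ⟨h1, h2⟩, hball ?_⟩
    rw [Metric.mem_ball, Real.dist_eq, abs_of_nonneg (by linarith)]; linarith
  have hlt : a < min b (a + ε / 2) := lt_min hab (by linarith)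
  have := measureReal_mono hsub (S.volume_ne_top ((S.gap_subset v).trans (S.cyl_subset_I v)))
  rw [Real.volume_real_Icc_of_le hlt.le] at this
  linarith

lemma image_gap_disjoint {v : List (Fin p)} (hv : v ≠ []) {w w' : List (Fin p)} (hne : w ≠ w') :
    Disjoint (S.comp w '' S.gap v) (S.comp w' '' S.gap v) := by
  have key : ∀ w w' : List (Fin p), w ≠ w' → w ++ v <+: w' ++ v → ∀ x ∈ S.comp w '' S.gap v,
      x ∈ S.comp w' '' S.gap v → False := by
    rintro w w' hne ⟨t, ht⟩ x ⟨y, hy, rfl⟩ hx'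
    cases t with
    | nil => exact hne (by simpa using ht)
    | cons a t =>
      have h1 : S.comp w y ∈ S.cyl (w ++ (v ++ [a])) := by
        have h2 : S.comp w y ∈ S.cyl (w' ++ v) := by
          rw [S.cyl_append w' hv]; exact image_mono (S.gap_subset v) hx'
        rw [← ht] at h2
        apply S.cyl_anti _ h2
        exact ⟨t, by simp⟩
      rw [S.cyl_append w (by simp)] at h1
      obtain ⟨z, hz, hzy⟩ := h1
      have : z = y := S.comp_injOn w (S.cyl_subset_dom (by simp) hz)
        (S.cyl_subset_dom hv (S.gap_subset v hy)) hzy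
      subst this
      exact hy.2 (mem_iUnion.2 ⟨a, hz⟩)
  rw [Set.disjoint_left]
  intro x hx hx'
  have h1 : x ∈ S.cyl (w ++ v) := by rw [S.cyl_append w hv]; exact image_mono (S.gap_subset v) hx
  have h2 : x ∈ S.cyl (w' ++ v) := by rw [S.cyl_append w' hv]; exact image_mono (S.gap_subset v) hx'
  rcases S.prefix_or_prefix_of_cyl_inter ⟨x, h1, h2⟩ with h | h
  · exact key w w' hne h x hx hx'
  · exact key w' w hne.symm h x hx' hx

lemma tsum_volume_image_gap_le {v : List (Fin p)} (hv : v ≠ []) :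
    ∑' w, volume (S.comp w '' S.gap v) ≤ volume S.I := by
  rw [← measure_iUnion (fun w w' h => S.image_gap_disjoint hv h) fun w =>
    S.measurableSet_image_comp w (S.measurableSet_gap v)
      ((S.gap_subset v).trans (S.cyl_subset_dom hv))]
  refine measure_mono (iUnion_subset fun w => ?_)
  exact (S.image_comp_subset_dom w ((S.gap_subset v).trans (S.cyl_subset_dom hv))).trans
    S.dom_subset_I

/-- The union of the cylinders of words of length `n`. -/
def levelSet (n : ℕ) : Set ℝ := ⋃ w : {w : List (Fin p) // w.length = n}, S.cyl w

lemma finite_words (n : ℕ) : Finite {w : List (Fin p) // w.length = n} :=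
  List.Vector.finite (n := n) (α := Fin p)

lemma isCompact_levelSet (n : ℕ) : IsCompact (S.levelSet n) := by
  have := finite_words (p := p) n
  exact isCompact_iUnion fun w => S.isCompact_cyl _

lemma cyl_subset_levelSet {w : List (Fin p)} {n : ℕ} (h : n ≤ w.length) :
    S.cyl w ⊆ S.levelSet n := by
  refine (S.cyl_anti (List.take_prefix n w)).trans ?_
  exact subset_iUnion_of_subset ⟨w.take n, by simp [h]⟩ subset_rfl

lemma levelSet_anti {m n : ℕ} (h : m ≤ n) : S.levelSet n ⊆ S.levelSet m :=
  iUnion_subset fun w => S.cyl_subset_levelSet (by rw [w.2]; exact h)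

lemma levelSet_subset_I (n : ℕ) : S.levelSet n ⊆ S.I :=
  iUnion_subset fun _ => S.cyl_subset_I _

lemma iInter_levelSet_subset : ⋂ n, S.levelSet n ⊆ range S.pt := by
  intro x hx
  have h : ∀ n, ∃ w : List (Fin p), w.length = n ∧ x ∈ S.cyl w := fun n => by
    obtain ⟨w, hw⟩ := mem_iUnion.1 (mem_iInter.1 hx n)
    exact ⟨w.1, w.2, hw⟩
  choose w hw hxw using h
  have hpre : ∀ m n, m ≤ n → w m <+: w n := fun m n hmn => by
    rcases S.prefix_or_prefix_of_cyl_inter ⟨x, hxw m, hxw n⟩ with h | h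
    · exact h
    · have := h.eq_of_length_le (by rw [hw, hw]; exact hmn)
      rw [this]
  let ω : ℕ → Fin p := fun n => (w (n + 1))[n]'(by rw [hw]; exact n.lt_succ_self)
  refine ⟨ω, (S.eq_pt 0 fun n _ => ?_).symm⟩
  have : wordOf ω n = w n := by
    apply List.ext_getElem (by simp [hw])
    intro i h1 h2
    rw [getElem_wordOf]
    exact (hpre (i + 1) n (by rw [hw] at h2; exact h2)).getElem _
  rw [this]; exact hxw n

end ExpansiveMarkovSystem

/-- The word `v` occurs in `r ++ v` at no position strictly between `0` and `r.length`. -/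
def IsSimple {α : Type*} (r v : List α) : Prop :=
  ∀ j, 0 < j → j < r.length → ¬ v <+: r.drop j ++ v

/-- `u` is a first return word of `v`. -/
structure IsReturn {α : Type*} (u v : List α) : Prop where
  ne_nil : u ≠ []
  prefix_append : v <+: u ++ v
  simple : IsSimple u v

section Returns

variable {α : Type*}

lemma prefix_of_prefix_append {u v w : List α} (h : v <+: w ++ v) :
    u ++ v <+: u ++ w ++ v := by
  rw [List.append_assoc]; exact (List.prefix_append_right_inj u).2 h

lemma exists_first_return (v : List α) {w : List α} (hw : w ≠ []) :
    ∃ u t, w = u ++ t ∧ u ≠ [] ∧ IsSimple u v ∧ v <+: t ++ v ∧ (v <+: w ++ v → v <+: u ++ v) := by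
  have hex : ∃ j, 0 < j ∧ j ≤ w.length ∧ v <+: w.drop j ++ v :=
    ⟨w.length, List.length_pos_iff.2 hw, le_rfl, by simp⟩
  obtain ⟨h0, hle, hpre⟩ := Nat.find_spec hex
  set j := Nat.find hex with hj
  have hlen : (w.take j).length = j := by simp [hle]
  refine ⟨w.take j, w.drop j, (List.take_append_drop j w).symm, ?_, ?_, hpre, ?_⟩
  · intro h; rw [h] at hlen; simp at hlen; omega
  · intro i hi0 hi h
    rw [hlen] at hi
    refine Nat.find_min hex hi ⟨hi0, by omega, h.trans ?_⟩
    have := prefix_of_prefix_append (u := (w.take j).drop i) hpre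
    convert this using 2
    conv_lhs => rw [← List.take_append_drop j w]
    rw [List.drop_append_of_le_length (by omega)]
  · intro h
    have := prefix_of_prefix_append (u := w.take j) hpre
    rw [List.take_append_drop] at this
    exact List.prefix_of_prefix_length_le h this (by simp)

end Returns

namespace ExpansiveMarkovSystem

variable {p : ℕ} (S : ExpansiveMarkovSystem p)

lemma sumLen_eq_sum (J : Set ℝ) (w : List (Fin p)) :
    S.sumLen J w = ∑ j ∈ Finset.range w.length, volume.real (S.comp (w.drop (j + 1)) '' J) := by
  induction w with
  | nil => simp
  | cons i w ih => rw [List.length_cons, Finset.sum_range_succ', sumLen_cons, ih, add_comm]; simp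

lemma disjoint_cyl_drop {r v : List (Fin p)} (h : IsSimple r v) {i j : ℕ} (hij : i < j)
    (hj : j < r.length) :
    Disjoint (S.cyl (r.drop (i + 1) ++ v)) (S.cyl (r.drop (j + 1) ++ v)) := by
  rw [Set.disjoint_iff_inter_eq_empty]
  by_contra hne
  rcases S.prefix_or_prefix_of_cyl_inter (Set.nonempty_iff_ne_empty.2 hne) with h1 | h1
  · have := h1.length_le
    simp at this
    omega
  · have h2 := h1.drop (r.length - (j + 1))
    rw [List.drop_left' (by simp), List.drop_append_of_le_length (by simp; omega),
      List.drop_drop] at h2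
    exact h _ (by omega) (by omega) h2

lemma pairwise_disjoint_cyl_drop {r v : List (Fin p)} (h : IsSimple r v) :
    (Finset.range r.length : Set ℕ).PairwiseDisjoint
      fun j => S.cyl (r.drop (j + 1) ++ v) := by
  intro i hi j hj hne
  have hi' := Finset.mem_range.1 hi
  have hj' := Finset.mem_range.1 hj
  rcases lt_or_gt_of_ne hne with hlt | hlt
  · exact S.disjoint_cyl_drop h hlt hj'
  · exact (S.disjoint_cyl_drop h hlt hi').symm

lemma sumLen_cyl_le {r v : List (Fin p)} (hv : v ≠ []) (h : IsSimple r v) {X : Set ℝ}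
    (hXI : X ⊆ S.I) (hX : ∀ t : List (Fin p), S.cyl (t ++ v) ⊆ X) :
    S.sumLen (S.cyl v) r ≤ volume.real X := by
  rw [sumLen_eq_sum]
  simp_rw [← S.cyl_append _ hv]
  rw [← measureReal_biUnion_finset (S.pairwise_disjoint_cyl_drop h)
    (fun _ _ => S.measurableSet_cyl _) (fun _ _ => S.volume_ne_top (S.cyl_subset_I _))]
  exact measureReal_mono (iUnion₂_subset fun _ _ => hX _) (S.volume_ne_top hXI)

lemma sumLen_cyl_le_I {r v : List (Fin p)} (hv : v ≠ []) (h : IsSimple r v) :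
    S.sumLen (S.cyl v) r ≤ volume.real S.I :=
  S.sumLen_cyl_le hv h subset_rfl fun _ => S.cyl_subset_I _

lemma sumLen_cyl_le_levelSet {r v : List (Fin p)} (hv : v ≠ []) (h : IsSimple r v) :
    S.sumLen (S.cyl v) r ≤ volume.real (S.levelSet v.length) :=
  S.sumLen_cyl_le hv h (S.levelSet_subset_I _) fun t => S.cyl_subset_levelSet (by simp)

lemma sumLen_mul_volume_le (u : List (Fin p)) {J : Set ℝ} (hc : IsPreconnected J)
    (hd : J ⊆ S.dom) (hJ : MeasurableSet J) {E : Set ℝ} (hE : MeasurableSet E) (hEJ : E ⊆ J) :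
    S.sumLen E u * volume.real J ≤
      Real.exp (S.lip * S.sumLen J u) * S.sumLen J u * volume.real E := by
  induction u with
  | nil => simp
  | cons i u ih =>
    have h1 := S.volume_image_mul_le u hc hd hE hEJ hJ subset_rfl
    have hle : Real.exp (S.lip * S.sumLen J u) ≤ Real.exp (S.lip * S.sumLen J (i :: u)) := by
      apply Real.exp_le_exp.2 (mul_le_mul_of_nonneg_left _ S.lip_nonneg)
      simp [measureReal_nonneg]
    set K := Real.exp (S.lip * S.sumLen J u)
    set K' := Real.exp (S.lip * S.sumLen J (i :: u))
    simp only [sumLen_cons]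
    have h2 : K * volume.real (S.comp u '' J) * volume.real E ≤
        K' * volume.real (S.comp u '' J) * volume.real E := by gcongr
    have h3 : K * S.sumLen J u * volume.real E ≤ K' * S.sumLen J u * volume.real E := by
      have := S.sumLen_nonneg J u
      gcongr
    linarith

lemma sumLen_le_of_contracting_returns {P : List (Fin p) → Prop}
    (hP : ∀ b c, b <:+: c → P c → P b) {v : List (Fin p)} (hv : v ≠ []) {l : ℝ} (hl : l < 1)
    (hret : ∀ u, IsReturn u v → P (u ++ v) → ∀ x ∈ S.cyl v, |S.der u x| ≤ l) :
    ∃ C : ℝ, ∀ w, P (w ++ v) → S.sumLen (S.cyl v) w ≤ C := by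
  set V := volume.real (S.cyl v) with hV
  have hVpos : 0 < V := S.volume_cyl_pos v
  set c := Real.exp (S.lip * volume.real S.I) * volume.real S.I with hc
  have hc0 : 0 ≤ c := by positivity
  have hsimple : ∀ r t : List (Fin p), IsSimple r v → v <+: t ++ v →
      S.sumLen (S.cyl (t ++ v)) r ≤ c * volume.real (S.cyl (t ++ v)) / V := by
    intro r t hr ht
    have h1 := S.sumLen_mul_volume_le r (S.isPreconnected_cyl v) (S.cyl_subset_dom hv)
      (S.measurableSet_cyl v) (S.measurableSet_cyl (t ++ v)) (S.cyl_anti ht)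
    have h2 := S.sumLen_cyl_le_I hv hr
    rw [le_div_iff₀ hVpos]
    refine h1.trans ?_
    have h3 := S.sumLen_nonneg (S.cyl v) r
    have h4 := S.lip_nonneg
    rw [hc]
    gcongr
  set C0 := c / (1 - l) with hC0
  have hC0' : c + C0 * l = C0 := by
    rw [hC0]; field_simp [(by linarith : (1 - l) ≠ 0)]; ring
  have hC0n : 0 ≤ C0 := div_nonneg hc0 (by linarith)
  have main : ∀ n, ∀ w : List (Fin p), w.length ≤ n → v <+: w ++ v → P (w ++ v) →
      S.sumLen (S.cyl v) w + C0 * (volume.real (S.cyl (w ++ v)) / V) ≤ C0 := by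
    intro n
    induction n with
    | zero =>
      intro w hw _ _
      rw [List.length_eq_zero_iff.1 (Nat.le_zero.1 hw)]
      simp only [sumLen_nil, List.nil_append]
      rw [div_self hVpos.ne']; linarith
    | succ n ih =>
      intro w hw hpre hPw
      rcases eq_or_ne w [] with rfl | hne
      · simp only [sumLen_nil, List.nil_append]
        rw [div_self hVpos.ne']; linarith
      obtain ⟨u, t, rfl, hu, hus, ht, hup⟩ := exists_first_return v hne
      have hPu : P (u ++ v) := hP _ _ (prefix_of_prefix_append ht).isInfix hPw
      have hPt : P (t ++ v) := hP _ _ ⟨u, [], by simp⟩ hPw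
      have hul : 0 < u.length := List.length_pos_iff.2 hu
      have h1 := ih t (by simp at hw; omega) ht hPt
      have h2 := hsimple u t hus ht
      have h3 : volume.real (S.cyl (u ++ t ++ v)) ≤ l * volume.real (S.cyl (t ++ v)) := by
        rw [List.append_assoc, S.cyl_append u (v := t ++ v) (by simp [hv])]
        exact S.volume_image_le u (S.measurableSet_cyl _)
          ((S.cyl_anti ht).trans (S.cyl_subset_dom hv))
          fun x hx => hret u ⟨hu, hup hpre, hus⟩ hPu x (S.cyl_anti ht hx)
      rw [sumLen_append, ← S.cyl_append t hv]
      have h4 : C0 * (volume.real (S.cyl (u ++ t ++ v)) / V) ≤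
          C0 * l * (volume.real (S.cyl (t ++ v)) / V) := by
        rw [mul_assoc]
        apply mul_le_mul_of_nonneg_left _ hC0n
        rw [← mul_div_assoc]; gcongr
      rw [mul_div_assoc] at h2
      have h5 : C0 * (volume.real (S.cyl (t ++ v)) / V) =
        c * (volume.real (S.cyl (t ++ v)) / V) + C0 * l * (volume.real (S.cyl (t ++ v)) / V) := by
        rw [← add_mul, hC0']
      linarith
  refine ⟨c + C0, fun w hPw => ?_⟩
  rcases eq_or_ne w [] with rfl | hne
  · simp only [sumLen_nil]; linarith
  obtain ⟨u, t, rfl, hu, hus, ht, hup⟩ := exists_first_return v hne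
  have h1 := main _ t le_rfl ht (hP _ _ ⟨u, [], by simp⟩ hPw)
  have h2 := hsimple u t hus ht
  rw [sumLen_append, ← S.cyl_append t hv]
  have h3 : volume.real (S.cyl (t ++ v)) / V ≤ 1 := (div_le_one hVpos).2 (S.volume_cyl_anti ht)
  have h4 : c * volume.real (S.cyl (t ++ v)) / V ≤ c := by
    rw [mul_div_assoc]; exact mul_le_of_le_one_right hc0 h3
  have h5 : 0 ≤ C0 * (volume.real (S.cyl (t ++ v)) / V) := by positivity
  linarith

lemma not_disjoint_of_half_lt {v : List (Fin p)} {X Y : Set ℝ} (hX : X ⊆ S.cyl v)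
    (hY : Y ⊆ S.cyl v) (hYm : MeasurableSet Y)
    (h1 : volume.real (S.cyl v) < 2 * volume.real X)
    (h2 : volume.real (S.cyl v) < 2 * volume.real Y) : ¬ Disjoint X Y := by
  intro hd
  have h3 := measureReal_union hd hYm (h₁ := S.volume_ne_top (hX.trans (S.cyl_subset_I v)))
    (h₂ := S.volume_ne_top (hY.trans (S.cyl_subset_I v)))
  have h4 := measureReal_mono (union_subset hX hY) (S.volume_ne_top (S.cyl_subset_I v))
  linarith

lemma IsReturn.eq_of_half_lt {v u u' : List (Fin p)} (hu : IsReturn u v)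
    (hu' : IsReturn u' v)
    (h1 : volume.real (S.cyl v) < 2 * volume.real (S.cyl (u ++ v)))
    (h2 : volume.real (S.cyl v) < 2 * volume.real (S.cyl (u' ++ v))) : u = u' := by
  by_contra hne
  have key : ∀ u u' : List (Fin p), IsReturn u v → IsReturn u' v → u ≠ u' →
      ¬ (u ++ v <+: u' ++ v) := by
    intro u u' hu hu' hne h
    have hlen : u.length ≤ u'.length := by have := h.length_le; simp at this; omega
    have hlt : u.length < u'.length := by
      rcases hlen.eq_or_lt with h' | h'
      · exact absurd (List.append_cancel_right (h.eq_of_length (by simp [h']))) hne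
      · exact h'
    have h2 := h.drop u.length
    rw [List.drop_left, List.drop_append_of_le_length hlen] at h2
    exact hu'.simple _ (List.length_pos_iff.2 hu.ne_nil) hlt h2
  apply S.not_disjoint_of_half_lt (S.cyl_anti hu.prefix_append) (S.cyl_anti hu'.prefix_append)
    (S.measurableSet_cyl _) h1 h2
  rw [Set.disjoint_iff_inter_eq_empty]
  by_contra hne'
  rcases S.prefix_or_prefix_of_cyl_inter (Set.nonempty_iff_ne_empty.2 hne') with h | h
  · exact key u u' hu hu' hne h
  · exact key u' u hu' hu (Ne.symm hne) h

/-- A noncontracting first return of `v`. -/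
def IsNoncontracting (u v : List (Fin p)) : Prop :=
  IsReturn u v ∧ 9 / 10 * volume.real (S.cyl v) < volume.real (S.cyl (u ++ v))

lemma IsNoncontracting.unique {u u' v : List (Fin p)} (h : S.IsNoncontracting u v)
    (h' : S.IsNoncontracting u' v) : u = u' :=
  IsReturn.eq_of_half_lt S h.1 h'.1 (by linarith [h.2, S.volume_cyl_pos v])
    (by linarith [h'.2, S.volume_cyl_pos v])

lemma noncontracting_eq_of_succ {P : List (Fin p) → Prop}
    (hP : ∀ b c, b <:+: c → P c → P b) {v : List (Fin p)} (hv : v ≠ []) {b : Fin p}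
    (hSM : ∀ r, IsSimple r v → P (r ++ v) →
      Real.exp (S.lip * S.sumLen (S.cyl v) r) ≤ 21 / 20)
    {u u' : List (Fin p)} (hu : S.IsNoncontracting u (v ++ [b])) (hPu : P (u ++ (v ++ [b])))
    (hu' : S.IsNoncontracting u' v) : u = u' := by
  have hVpos : 0 < volume.real (S.cyl v) := S.volume_cyl_pos v
  have hvb : v <+: v ++ [b] := List.prefix_append _ _
  have hap : ∀ t : List (Fin p), t ++ v <+: t ++ (v ++ [b]) := fun t =>
    (List.prefix_append_right_inj t).2 hvb
  have hpre : v <+: u ++ v :=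
    List.prefix_of_prefix_length_le (hvb.trans hu.1.prefix_append) (hap u) (by simp)
  obtain ⟨a, t, rfl, ha, has, ht, hap'⟩ := exists_first_return v hu.1.ne_nil
  have haret : IsReturn a v := ⟨ha, hap' hpre, has⟩
  have hPa : P (a ++ v) :=
    hP _ _ ((prefix_of_prefix_append ht).trans (hap _)).isInfix hPu
  have hKa := hSM a has hPa
  rcases eq_or_ne t [] with rfl | htne
  · simp only [List.append_nil] at *
    refine IsReturn.eq_of_half_lt S haret hu'.1 ?_ (by linarith [hu'.2])
    have h1 := S.volume_image_mul_le a (S.isPreconnected_cyl v) (S.cyl_subset_dom hv)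
      (S.measurableSet_cyl _) (S.cyl_append_subset v [b]) (S.measurableSet_cyl v) subset_rfl
    rw [← S.cyl_append a (by simp), ← S.cyl_append a hv] at h1
    have h2 := hu.2
    have h3 := S.volume_cyl_pos (v ++ [b])
    have h4 := S.volume_cyl_pos (a ++ v)
    have h5 : Real.exp (S.lip * S.sumLen (S.cyl v) a) * volume.real (S.cyl (a ++ v)) *
        volume.real (S.cyl (v ++ [b])) ≤
        21 / 20 * volume.real (S.cyl (a ++ v)) * volume.real (S.cyl (v ++ [b])) := by gcongr
    have h6 : 9 / 10 * volume.real (S.cyl (v ++ [b])) * volume.real (S.cyl v) ≤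
        volume.real (S.cyl (a ++ (v ++ [b]))) * volume.real (S.cyl v) := by gcongr
    have h7 : 9 / 10 * volume.real (S.cyl v) ≤ 21 / 20 * volume.real (S.cyl (a ++ v)) := by
      apply le_of_mul_le_mul_right _ h3
      linarith
    linarith
  exfalso
  obtain ⟨c, s, rfl, hc, hcs, hs, hcp⟩ := exists_first_return v htne
  have hPc : P (c ++ v) := by
    refine hP _ _ ?_ hPu
    have h1 : c ++ v <+: c ++ s ++ (v ++ [b]) := (prefix_of_prefix_append hs).trans (hap _)
    exact h1.isInfix.trans ⟨a, [], by simp⟩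
  have hKc := hSM c hcs hPc
  have hav : v ++ [b] <+: a ++ v := by
    refine List.prefix_of_prefix_length_le hu.1.prefix_append
      ((prefix_of_prefix_append ht).trans (hap _)) ?_
    have := List.length_pos_iff.2 ha
    simp; omega
  set D := volume.real (S.cyl v)
  have hXt : S.cyl (c ++ s ++ (v ++ [b])) ⊆ S.cyl v := S.cyl_anti (ht.trans (hap _))
  have hXs : S.cyl (s ++ (v ++ [b])) ⊆ S.cyl v := S.cyl_anti (hs.trans (hap _))
  have hcv : volume.real (S.cyl (c ++ v)) ≤ D := S.volume_cyl_anti (hcp ht)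
  have g1 := S.volume_sub_mul_le a (S.isPreconnected_cyl v) (S.cyl_subset_dom hv)
    (S.measurableSet_cyl _) hXt (S.measurableSet_cyl v) subset_rfl
  have g2 := S.volume_sub_mul_le c (S.isPreconnected_cyl v) (S.cyl_subset_dom hv)
    (S.measurableSet_cyl _) hXs (S.measurableSet_cyl v) subset_rfl
  rw [← S.cyl_append a hv, ← S.cyl_append a (by simp), ← List.append_assoc a] at g1
  rw [← S.cyl_append c hv, ← S.cyl_append c (by simp), ← List.append_assoc c] at g2
  have hd := S.disjoint_cyl_drop hu.1.simple (i := a.length - 1) (j := a.length + c.length - 1)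
    (by have := List.length_pos_iff.2 hc; have := List.length_pos_iff.2 ha; omega)
    (by have := List.length_pos_iff.2 hc; have := List.length_pos_iff.2 ha; simp; omega)
  rw [Nat.sub_add_cancel (by have := List.length_pos_iff.2 ha; omega),
    Nat.sub_add_cancel (by have := List.length_pos_iff.2 ha; omega), List.drop_left,
    ← List.append_assoc a c, ← List.length_append, List.drop_left] at hd
  have hmono := S.volume_cyl_anti hav
  have hsub : volume.real (S.cyl (a ++ (c ++ s) ++ (v ++ [b]))) ≤ volume.real (S.cyl (a ++ v)) :=
    S.volume_cyl_anti ((prefix_of_prefix_append ht).trans (hap _))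
  have hbig := hu.2
  have hAv := S.volume_cyl_pos (a ++ v)
  have hCv := S.volume_cyl_pos (c ++ v)
  have hsub2 : volume.real (S.cyl (c ++ s ++ (v ++ [b]))) ≤ volume.real (S.cyl (c ++ v)) :=
    S.volume_cyl_anti ((prefix_of_prefix_append hs).trans (hap _))
  have e1 : D - volume.real (S.cyl (c ++ s ++ (v ++ [b]))) ≤ 21 / 200 * D := by
    apply le_of_mul_le_mul_right _ hAv
    refine g1.trans ?_
    have : Real.exp (S.lip * S.sumLen (S.cyl v) a) * (volume.real (S.cyl (a ++ v)) -
        volume.real (S.cyl (a ++ (c ++ s) ++ (v ++ [b])))) * D ≤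
        21 / 20 * (1 / 10 * volume.real (S.cyl (a ++ v))) * D := by
      gcongr
      linarith
    linarith
  have e2 : D - volume.real (S.cyl (s ++ (v ++ [b]))) ≤ 21 / 20 * (21 / 200) * D := by
    apply le_of_mul_le_mul_right _ hCv
    refine g2.trans ?_
    have h8 : volume.real (S.cyl (c ++ v)) - volume.real (S.cyl (c ++ s ++ (v ++ [b]))) ≤
        21 / 200 * volume.real (S.cyl (c ++ v)) := by linarith
    have : Real.exp (S.lip * S.sumLen (S.cyl v) c) * (volume.real (S.cyl (c ++ v)) -
        volume.real (S.cyl (c ++ s ++ (v ++ [b])))) * D ≤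
        21 / 20 * (21 / 200 * volume.real (S.cyl (c ++ v))) * D := by
      gcongr
    linarith
  exact S.not_disjoint_of_half_lt hXt hXs (S.measurableSet_cyl _) (by linarith) (by linarith) hd

lemma contracting_or_periodic {P : List (Fin p) → Prop}
    (hP : ∀ b c, b <:+: c → P c → P b) (x : ℕ → Fin p) {n₀ : ℕ} (hn₀ : n₀ ≠ 0)
    (hSM : ∀ n ≥ n₀, ∀ r, IsSimple r (wordOf x n) → P (r ++ wordOf x n) →
      Real.exp (S.lip * S.sumLen (S.cyl (wordOf x n)) r) ≤ 21 / 20) :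
    (∃ n ≥ n₀, ∀ u, IsReturn u (wordOf x n) → P (u ++ wordOf x n) →
      ∀ z ∈ S.cyl (wordOf x n), |S.der u z| ≤ 189 / 200) ∨
    ∃ u, S.IsNoncontracting u (wordOf x n₀) ∧ seqAppend u x = x := by
  by_cases hA : ∃ n ≥ n₀, ∀ u, IsReturn u (wordOf x n) → P (u ++ wordOf x n) →
      ∀ z ∈ S.cyl (wordOf x n), |S.der u z| ≤ 189 / 200
  · exact Or.inl hA
  right
  push Not at hA
  have hnc : ∀ n ≥ n₀, ∃ u, S.IsNoncontracting u (wordOf x n) ∧ P (u ++ wordOf x n) := by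
    intro n hn
    obtain ⟨u, hu, hPu, z, hz, hlt⟩ := hA n hn
    refine ⟨u, ⟨hu, ?_⟩, hPu⟩
    have hv : wordOf x n ≠ [] := wordOf_ne_nil x (by omega)
    have h1 := S.abs_der_mul_volume_le u (S.isPreconnected_cyl _) (S.cyl_subset_dom hv) hz
      (S.measurableSet_cyl _) subset_rfl
    rw [← S.cyl_append u hv] at h1
    have h2 := hSM n hn u hu.simple hPu
    have h3 := S.volume_cyl_pos (wordOf x n)
    have h4 := S.volume_cyl_pos (u ++ wordOf x n)
    have h5 : Real.exp (S.lip * S.sumLen (S.cyl (wordOf x n)) u) *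
      volume.real (S.cyl (u ++ wordOf x n)) ≤ 21 / 20 * volume.real (S.cyl (u ++ wordOf x n)) := by
      gcongr
    have h6 : 189 / 200 * volume.real (S.cyl (wordOf x n)) <
      |S.der u z| * volume.real (S.cyl (wordOf x n)) := by gcongr
    linarith
  obtain ⟨u, hu, hPu⟩ := hnc n₀ le_rfl
  have hall : ∀ n ≥ n₀, S.IsNoncontracting u (wordOf x n) := by
    intro n hn
    induction n, hn using Nat.le_induction with
    | base => exact hu
    | succ n hn ih =>
      obtain ⟨u', hu', hPu'⟩ := hnc (n + 1) (by omega)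
      have := hu'
      rw [wordOf_succ] at hu' hPu'
      rw [← S.noncontracting_eq_of_succ hP (wordOf_ne_nil x (by omega)) (hSM n hn) hu' hPu' ih]
      exact this
  refine ⟨u, hu, ?_⟩
  apply seq_ext_wordOf
  intro n
  have h1 := (hall (n + n₀) (by omega)).1.prefix_append
  rw [← wordOf_seqAppend] at h1
  have h2 := eq_wordOf_of_prefix_wordOf h1
  rw [length_wordOf] at h2
  exact (wordOf_eq_of_le (by omega) h2).symm

end ExpansiveMarkovSystem

/-- A factor-closed, right-extendable set of words. -/
structure IsLanguage {α : Type*} (P : List α → Prop) : Prop where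
  of_factor : ∀ b c, b <:+: c → P c → P b
  extend : ∀ u, P u → ∃ a, P (u ++ [a])

/-- The sequences all of whose finite prefixes belong to `P`. -/
def seqsOf {p : ℕ} (P : List (Fin p) → Prop) : Set (ℕ → Fin p) := {ζ | ∀ n, P (wordOf ζ n)}

lemma IsLanguage.exists_extension {α : Type*} {P : List α → Prop} (hP : IsLanguage P)
    {u : List α} (hu : P u) (n : ℕ) : ∃ t : List α, t.length = n ∧ P (u ++ t) := by
  induction n with
  | zero => exact ⟨[], rfl, by simpa⟩
  | succ n ih =>
    obtain ⟨t, ht, hPt⟩ := ih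
    obtain ⟨a, ha⟩ := hP.extend _ hPt
    exact ⟨t ++ [a], by simp [ht], by simpa using ha⟩

lemma IsLanguage.seqDrop_mem {p : ℕ} {P : List (Fin p) → Prop} (hP : IsLanguage P)
    {ζ : ℕ → Fin p} (h : ζ ∈ seqsOf P) (k : ℕ) : seqDrop k ζ ∈ seqsOf P := by
  intro n
  refine hP.of_factor _ _ ?_ (h (k + n))
  rw [wordOf_add]
  exact (List.suffix_append _ _).isInfix

namespace ExpansiveMarkovSystem

variable {p : ℕ} (S : ExpansiveMarkovSystem p)

/-- The union of the cylinders of the words of length `n` in `P`. -/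
def levelSetOf (P : List (Fin p) → Prop) (n : ℕ) : Set ℝ :=
  ⋃ w : {w : List (Fin p) // w.length = n ∧ P w}, S.cyl w

lemma isCompact_levelSetOf (P : List (Fin p) → Prop) (n : ℕ) :
    IsCompact (S.levelSetOf P n) := by
  have := finite_words (p := p) n
  have : Finite {w : List (Fin p) // w.length = n ∧ P w} :=
    Finite.of_injective (fun w => (⟨w.1, w.2.1⟩ : {w : List (Fin p) // w.length = n}))
      fun a b h => by simpa [Subtype.ext_iff] using h
  exact isCompact_iUnion fun w => S.isCompact_cyl _

lemma levelSetOf_succ_subset {P : List (Fin p) → Prop} (hP : IsLanguage P) (n : ℕ) :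
    S.levelSetOf P (n + 1) ⊆ S.levelSetOf P n := by
  refine iUnion_subset fun w => ?_
  have h1 : w.1.take n <+: w.1 := List.take_prefix n w.1
  refine (S.cyl_anti h1).trans (subset_iUnion_of_subset
    ⟨w.1.take n, by simp [w.2.1], hP.of_factor _ _ h1.isInfix w.2.2⟩ subset_rfl)

lemma iInter_levelSetOf (P : List (Fin p) → Prop) :
    ⋂ n, S.levelSetOf P n = S.pt '' seqsOf P := by
  apply subset_antisymm
  · intro x hx
    have h : ∀ n, ∃ w : List (Fin p), (w.length = n ∧ P w) ∧ x ∈ S.cyl w := fun n => by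
      obtain ⟨w, hw⟩ := mem_iUnion.1 (mem_iInter.1 hx n)
      exact ⟨w.1, w.2, hw⟩
    have hx' : x ∈ ⋂ n, S.levelSet n := by
      refine mem_iInter.2 fun n => ?_
      obtain ⟨w, hw, hxw⟩ := h n
      exact S.cyl_subset_levelSet hw.1.ge hxw
    obtain ⟨ζ, rfl⟩ := S.iInter_levelSet_subset hx'
    refine ⟨ζ, fun n => ?_, rfl⟩
    obtain ⟨w, ⟨rfl, hw⟩, hxw⟩ := h n
    rwa [S.wordOf_eq_of_pt_mem hxw]
  · rintro _ ⟨ζ, hζ, rfl⟩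
    exact mem_iInter.2 fun n => mem_iUnion.2 ⟨⟨wordOf ζ n, by simp, hζ n⟩, S.pt_mem ζ n⟩

lemma isCompact_image_seqsOf (P : List (Fin p) → Prop) : IsCompact (S.pt '' seqsOf P) := by
  rw [← iInter_levelSetOf]
  exact (S.isCompact_levelSetOf P 0).of_isClosed_subset
    (isClosed_iInter fun n => (S.isCompact_levelSetOf P n).isClosed) (iInter_subset _ 0)

lemma exists_mem_seqsOf (S : ExpansiveMarkovSystem p) {P : List (Fin p) → Prop} (hP : IsLanguage P)
    {u : List (Fin p)} (hu : P u) : ∃ ζ ∈ seqsOf P, wordOf ζ u.length = u := by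
  have hne : (⋂ n, S.cyl u ∩ S.levelSetOf P n).Nonempty := by
    apply IsCompact.nonempty_iInter_of_sequence_nonempty_isCompact_isClosed
    · exact fun n => inter_subset_inter_right _ (S.levelSetOf_succ_subset hP n)
    · intro n
      obtain ⟨t, ht, hPt⟩ := hP.exists_extension hu n
      obtain ⟨x, hx⟩ := S.cyl_nonempty (u ++ t)
      refine ⟨x, S.cyl_append_subset _ _ hx, mem_iUnion.2 ⟨⟨(u ++ t).take n, by simp [ht],
        hP.of_factor _ _ (List.take_prefix _ _).isInfix hPt⟩, S.cyl_anti (List.take_prefix _ _) hx⟩⟩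
    · exact (S.isCompact_cyl u).inter (S.isCompact_levelSetOf P 0)
    · exact fun n => ((S.isCompact_cyl u).inter (S.isCompact_levelSetOf P n)).isClosed
  obtain ⟨x, hx⟩ := hne
  rw [← inter_iInter, iInter_levelSetOf] at hx
  obtain ⟨hxu, ζ, hζ, rfl⟩ := hx
  exact ⟨ζ, hζ, S.wordOf_eq_of_pt_mem hxu⟩

lemma image_comp_notMem {P : List (Fin p) → Prop} (hP : IsLanguage P) {u w : List (Fin p)}
    (hw : w ≠ []) {t : ℝ} (ht : t ∈ S.cyl w) (h : S.comp u t ∈ S.pt '' seqsOf P) :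
    t ∈ S.pt '' seqsOf P := by
  obtain ⟨ζ, hζ, hζt⟩ := h
  have h1 : S.pt ζ ∈ S.cyl (u ++ w) := by
    rw [hζt, S.cyl_append u hw]; exact mem_image_of_mem _ ht
  have h2 : wordOf ζ u.length = u := S.wordOf_eq_of_pt_mem (S.cyl_append_subset u w h1)
  have h3 : seqAppend u (seqDrop u.length ζ) = ζ := by
    conv_lhs => rw [← h2, length_wordOf]
    exact seqAppend_wordOf ζ _
  refine ⟨seqDrop u.length ζ, hP.seqDrop_mem hζ _, ?_⟩
  apply S.comp_injOn u (S.pt_mem_dom _) (S.cyl_subset_dom hw ht)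
  rw [comp_pt, h3, hζt]

lemma exists_volume_cthickening_sdiff_le {Y : Set ℝ} (hY : IsCompact Y) {η : ℝ} (hη : 0 < η) :
    ∃ δ > 0, volume.real (cthickening δ Y \ Y) ≤ η := by
  have h := tendsto_measure_cthickening_of_isCompact (μ := volume) hY
  have hfin : volume Y ≠ ⊤ := hY.measure_lt_top.ne
  have h2 : ∀ᶠ r in nhds (0 : ℝ), volume (cthickening r Y) < volume Y + ENNReal.ofReal η :=
    h.eventually_lt_const (ENNReal.lt_add_right hfin (by simpa using hη))
  obtain ⟨δ, hδ, hball⟩ := Metric.eventually_nhds_iff.1 h2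
  refine ⟨δ / 2, by positivity, ?_⟩
  have h3 := hball (y := δ / 2) (by rw [Real.dist_eq, sub_zero, abs_of_pos (by positivity)]; linarith)
  have h4 : volume (cthickening (δ / 2) Y \ Y) ≤ ENNReal.ofReal η := by
    rw [measure_sdiff (self_subset_cthickening Y) hY.isClosed.measurableSet.nullMeasurableSet hfin]
    exact tsub_le_iff_left.2 h3.le
  exact ENNReal.toReal_le_of_le_ofReal hη.le h4

lemma sumLen_le_length_mul (w : List (Fin p)) {J : Set ℝ} (hd : J ⊆ S.dom) :
    S.sumLen J w ≤ w.length * volume.real S.I := by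
  induction w with
  | nil => simp
  | cons i w ih =>
    have : volume.real (S.comp w '' J) ≤ volume.real S.I :=
      measureReal_mono ((S.image_comp_subset_dom w hd).trans S.dom_subset_I)
        (S.volume_ne_top subset_rfl)
    simp only [sumLen_cons, List.length_cons]; push_cast; linarith

lemma sumLen_drop_le (J : Set ℝ) (w : List (Fin p)) (j : ℕ) :
    S.sumLen J (w.drop j) ≤ S.sumLen J w := by
  conv_rhs => rw [← List.take_append_drop j w, sumLen_append]
  linarith [S.sumLen_nonneg (S.comp (w.drop j) '' J) (w.take j)]

lemma sum_volume_le_two_mul {ι : Type*} {s : Finset ι} {T : ι → Set ℝ} {y : ι → ℝ} {R : Set ℝ}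
    (hR : volume R ≠ ⊤) (hT : ∀ i ∈ s, MeasurableSet (T i)) (hTR : ∀ i ∈ s, T i ⊆ R)
    (hy : ∀ i ∈ s, y i ∉ T i)
    (h1 : ∀ i ∈ s, ∀ j ∈ s, i ≠ j → ∀ z, z ∈ T i → z ∈ T j → z < y i → z < y j → False)
    (h2 : ∀ i ∈ s, ∀ j ∈ s, i ≠ j → ∀ z, z ∈ T i → z ∈ T j → y i < z → y j < z → False) :
    ∑ i ∈ s, volume.real (T i) ≤ 2 * volume.real R := by
  have hfin : ∀ i ∈ s, volume (T i) ≠ ⊤ := fun i hi => measure_ne_top_of_subset (hTR i hi) hR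
  have e1 : ∑ i ∈ s, volume.real (T i ∩ Iio (y i)) ≤ volume.real R := by
    rw [← measureReal_biUnion_finset (h := fun i hi =>
      measure_ne_top_of_subset inter_subset_left (hfin i hi))]
    · exact measureReal_mono (iUnion₂_subset fun i hi => inter_subset_left.trans (hTR i hi)) hR
    · intro i hi j hj hij
      exact Set.disjoint_left.2 fun z hz hz' => h1 i hi j hj hij z hz.1 hz'.1 hz.2 hz'.2
    · exact fun i hi => (hT i hi).inter measurableSet_Iio
  have e2 : ∑ i ∈ s, volume.real (T i ∩ Ioi (y i)) ≤ volume.real R := by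
    rw [← measureReal_biUnion_finset (h := fun i hi =>
      measure_ne_top_of_subset inter_subset_left (hfin i hi))]
    · exact measureReal_mono (iUnion₂_subset fun i hi => inter_subset_left.trans (hTR i hi)) hR
    · intro i hi j hj hij
      exact Set.disjoint_left.2 fun z hz hz' => h2 i hi j hj hij z hz.1 hz'.1 hz.2 hz'.2
    · exact fun i hi => (hT i hi).inter measurableSet_Ioi
  have e3 : ∀ i ∈ s, volume.real (T i) ≤
      volume.real (T i ∩ Iio (y i)) + volume.real (T i ∩ Ioi (y i)) := by
    intro i hi
    refine le_trans (measureReal_mono ?_ ?_) (measureReal_union_le _ _)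
    · intro z hz
      rcases lt_trichotomy z (y i) with h | h | h
      · exact Or.inl ⟨hz, h⟩
      · exact absurd (h ▸ hz) (hy i hi)
      · exact Or.inr ⟨hz, h⟩
    · rw [← inter_union_distrib_left]
      exact measure_ne_top_of_subset inter_subset_left (hfin i hi)
  have e4 := Finset.sum_le_sum e3
  rw [Finset.sum_add_distrib] at e4
  linarith

lemma exists_sumLen_le_of_isLeast {P : List (Fin p) → Prop} (hP : IsLanguage P)
    {e : ℕ → Fin p} (he : ∀ ζ ∈ seqsOf P, S.pt e ≤ S.pt ζ) (s : List (Fin p)) {η : ℝ}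
    (hη : 0 < η) : ∃ k₀ : ℕ, ∀ k ≥ k₀, ∀ r, IsSimple r (s ++ wordOf e k) →
      P (r ++ (s ++ wordOf e k)) → S.sumLen (S.cyl (s ++ wordOf e k)) r ≤ η := by
  set Y := S.pt '' seqsOf P with hYdef
  have hY : IsCompact Y := S.isCompact_image_seqsOf P
  have hlip := S.lip_nonneg
  set K₁ := Real.exp (S.lip * (volume.real S.I + 2 + s.length * volume.real S.I)) with hK₁
  have hK₁pos : 0 < K₁ := Real.exp_pos _
  obtain ⟨δ, hδ, hR⟩ := exists_volume_cthickening_sdiff_le hY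
    (η := min 1 (η / (2 * K₁))) (lt_min one_pos (by positivity))
  set R := cthickening δ Y \ Y with hRdef
  have hRfin : volume R ≠ ⊤ := measure_ne_top_of_subset sdiff_subset
    (hY.cthickening.measure_lt_top.ne)
  obtain ⟨m₁, hm₁⟩ := S.exists_volume_cyl_lt hδ
  set m := m₁ + 1 with hm
  have hem : wordOf e m ≠ [] := wordOf_ne_nil e (by omega)
  obtain ⟨ρ, hρ, hball⟩ := Metric.mem_nhds_iff.1 (S.cyl_wordOf_mem_nhds e (n := m) (by omega))
  obtain ⟨k₁, hk₁⟩ := S.exists_volume_cyl_lt hρ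
  refine ⟨max k₁ m, fun k hk r hr hPr => ?_⟩
  have hek : wordOf e k ≠ [] := wordOf_ne_nil e (by have := le_of_max_le_right hk; omega)
  set v := s ++ wordOf e k with hv
  have hvne : v ≠ [] := by simp [hv, hek]
  set l := volume.real (S.cyl (wordOf e k)) with hl
  have hlpos : 0 < l := S.volume_cyl_pos _
  have hlρ : l < ρ := hk₁ _ (by simpa using le_of_max_le_left hk)
  have hckm : S.cyl (wordOf e k) ⊆ S.cyl (wordOf e m) :=
    S.cyl_anti (wordOf_prefix_wordOf e (le_of_max_le_right hk))
  set T' := Ico (S.pt e - l) (S.pt e) with hT'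
  have hT'm : Icc (S.pt e - l) (S.pt e) ⊆ S.cyl (wordOf e m) := by
    intro z hz
    apply hball
    rw [Metric.mem_ball, Real.dist_eq, abs_lt]
    constructor <;> linarith [hz.1, hz.2]
  set J := S.cyl (wordOf e k) ∪ Icc (S.pt e - l) (S.pt e) with hJ
  have hJm : J ⊆ S.cyl (wordOf e m) := union_subset hckm hT'm
  have hJd : J ⊆ S.dom := hJm.trans (S.cyl_subset_dom hem)
  have hJc : IsPreconnected J := IsPreconnected.union (S.pt e) (S.pt_mem e k)
    (right_mem_Icc.2 (by linarith)) (S.isPreconnected_cyl _) isPreconnected_Icc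
  have hT'J : T' ⊆ J := Ico_subset_Icc_self.trans subset_union_right
  have hT'd : T' ⊆ S.dom := hT'J.trans hJd
  have hJT : J ⊆ S.cyl (wordOf e k) ∪ T' := by
    rintro z (hz | hz)
    · exact Or.inl hz
    · rcases hz.2.eq_or_lt with h | h
      · exact Or.inl (h ▸ S.pt_mem e k)
      · exact Or.inr ⟨hz.1, h⟩
  have hT'Y : ∀ z ∈ T', z ∉ Y := by
    rintro z hz ⟨ζ, hζ, rfl⟩
    exact absurd (he ζ hζ) (not_le.2 hz.2)
  let φ : ℕ → ℝ → ℝ := fun j => S.comp (r.drop (j + 1) ++ s)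
  have hφv : ∀ j, φ j '' S.cyl (wordOf e k) = S.cyl (r.drop (j + 1) ++ v) := fun j => by
    rw [hv, ← List.append_assoc, S.cyl_append _ hek]
  have hφY : ∀ j, ∀ t ∈ J, φ j t ∈ Y → φ j t ∈ S.cyl (r.drop (j + 1) ++ v) := by
    intro j t ht h
    have htY : t ∈ Y := S.image_comp_notMem hP hem (hJm ht) h
    rcases hJT ht with h' | h'
    · rw [← hφv]; exact mem_image_of_mem _ h'
    · exact absurd htY (hT'Y t h')
  have hyex : ∀ j, ∃ y, y ∈ Y ∧ y ∈ S.cyl (r.drop (j + 1) ++ v) := by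
    intro j
    have h1 : P (r.drop (j + 1) ++ v) := by
      refine hP.of_factor _ _ ?_ hPr
      exact ⟨r.take (j + 1), [], by rw [← List.append_assoc, List.take_append_drop]; simp⟩
    obtain ⟨ζ, hζ, hw⟩ := S.exists_mem_seqsOf hP h1
    exact ⟨S.pt ζ, mem_image_of_mem _ hζ, hw ▸ S.pt_mem ζ _⟩
  choose y hyY hyc using hyex
  have hTm : ∀ j, φ j '' J ⊆ S.cyl (r.drop (j + 1) ++ s ++ wordOf e m) := fun j => by
    rw [S.cyl_append _ hem]; exact image_mono hJm
  have hyJ : ∀ j, y j ∈ φ j '' J := fun j =>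
    image_mono subset_union_left ((hφv j).symm ▸ hyc j)
  have hconn : ∀ j, (φ j '' J).OrdConnected := fun j =>
    (S.isPreconnected_image_comp _ hJc hJd).ordConnected
  have hsep : ∀ i ∈ Finset.range r.length, ∀ j ∈ Finset.range r.length, i ≠ j →
      y i ∉ φ j '' J := by
    rintro i hi j hj hij ⟨t, ht, hty⟩
    have h1 := hφY j t ht (hty ▸ hyY i)
    rw [hty] at h1
    exact Set.disjoint_left.1 (S.pairwise_disjoint_cyl_drop hr hi hj hij) (hyc i) h1
  have hsum : ∑ j ∈ Finset.range r.length, volume.real (φ j '' T') ≤ 2 * volume.real R := by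
    refine sum_volume_le_two_mul (y := y) hRfin
      (fun j _ => S.measurableSet_image_comp _ measurableSet_Ico hT'd) ?_ ?_ ?_ ?_
    · rintro j - _ ⟨t, ht, rfl⟩
      refine ⟨?_, fun h => hT'Y t ht (S.image_comp_notMem hP hem (hJm (hT'J ht)) h)⟩
      refine mem_cthickening_of_dist_le _ (y j) δ Y (hyY j) ?_
      rw [Real.dist_eq]
      refine (S.abs_sub_le_volume_cyl (hTm j (mem_image_of_mem _ (hT'J ht)))
        (hTm j (hyJ j))).trans (hm₁ _ ?_).le
      simp; omega
    · rintro j - ⟨t, ht, hty⟩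
      exact hT'Y t ht (S.image_comp_notMem hP hem (hJm (hT'J ht)) (by
        show φ j t ∈ Y
        rw [hty]; exact hyY j))
    · intro i hi j hj hij z hz hz' h h'
      rcases le_total (y i) (y j) with hle | hle
      · exact hsep i hi j hj hij ((hconn j).out (image_mono hT'J hz') (hyJ j) ⟨h.le, hle⟩)
      · exact hsep j hj i hi hij.symm ((hconn i).out (image_mono hT'J hz) (hyJ i) ⟨h'.le, hle⟩)
    · intro i hi j hj hij z hz hz' h h'
      rcases le_total (y i) (y j) with hle | hle
      · exact hsep j hj i hi hij.symm ((hconn i).out (hyJ i) (image_mono hT'J hz) ⟨hle, h'.le⟩)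
      · exact hsep i hi j hj hij ((hconn j).out (hyJ j) (image_mono hT'J hz') ⟨hle, h.le⟩)
  have hRle := hR
  have hJsum : S.sumLen (S.comp s '' J) r ≤ volume.real S.I + 2 := by
    rw [sumLen_eq_sum]
    have h1 : ∀ j ∈ Finset.range r.length,
        volume.real (S.comp (r.drop (j + 1)) '' (S.comp s '' J)) ≤
        volume.real (S.comp (r.drop (j + 1)) '' S.cyl v) + volume.real (φ j '' T') := by
      intro j _
      rw [← image_comp_append, ← S.cyl_append _ hvne, ← hφv]
      refine le_trans (measureReal_mono ?_ ?_) (measureReal_union_le _ _)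
      · rw [← image_union]; exact image_mono hJT
      · rw [← image_union]
        exact S.volume_ne_top ((S.image_comp_subset_dom _ (union_subset
          (S.cyl_subset_dom hek) hT'd)).trans S.dom_subset_I)
    have h2 := Finset.sum_le_sum h1
    rw [Finset.sum_add_distrib] at h2
    have h3 := S.sumLen_cyl_le_I hvne hr
    rw [sumLen_eq_sum] at h3
    have h4 := hRle.trans (min_le_left _ _)
    linarith
  have hcomp : ∀ j ∈ Finset.range r.length,
      volume.real (S.comp (r.drop (j + 1)) '' S.cyl v) ≤ K₁ * volume.real (φ j '' T') := by
    intro j _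
    rw [← S.cyl_append _ hvne, ← hφv]
    have h1 := S.volume_image_mul_le (r.drop (j + 1) ++ s) hJc hJd (S.measurableSet_cyl _)
      subset_union_left (measurableSet_Ico (a := S.pt e - l) (b := S.pt e)) hT'J
    rw [Real.volume_real_Ico_of_le (by linarith), sub_sub_cancel] at h1
    have h2 : Real.exp (S.lip * S.sumLen J (r.drop (j + 1) ++ s)) ≤ K₁ := by
      apply Real.exp_le_exp.2
      apply mul_le_mul_of_nonneg_left _ hlip
      rw [sumLen_append]
      have h3 := S.sumLen_le_length_mul s hJd
      have h4 := S.sumLen_drop_le (S.comp s '' J) r (j + 1)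
      linarith
    refine (le_of_mul_le_mul_right h1 hlpos).trans ?_
    gcongr
  rw [sumLen_eq_sum]
  refine (Finset.sum_le_sum hcomp).trans ?_
  rw [← Finset.mul_sum]
  have h4 := hRle.trans (min_le_right _ _)
  rw [le_div_iff₀ (by positivity)] at h4
  have h5 := mul_le_mul_of_nonneg_left hsum hK₁pos.le
  linarith

end ExpansiveMarkovSystem

section Recurrence

variable {p : ℕ}

/-- The word `u` occurs in the sequence `y` at position `k`. -/
def OccursAt (y : ℕ → Fin p) (u : List (Fin p)) (k : ℕ) : Prop :=
  wordOf (seqDrop k y) u.length = u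

lemma occursAt_append {y : ℕ → Fin p} {u v : List (Fin p)} {k : ℕ} :
    OccursAt y (u ++ v) k ↔ OccursAt y u k ∧ OccursAt y v (k + u.length) := by
  unfold OccursAt
  rw [List.length_append, wordOf_add, ← seqDrop_add, add_comm k]
  constructor
  · intro h
    exact List.append_inj h (by simp)
  · rintro ⟨h1, h2⟩
    rw [h1, h2]

lemma occursAt_wordOf (y : ℕ → Fin p) (k n : ℕ) : OccursAt y (wordOf (seqDrop k y) n) k := by
  simp [OccursAt]

lemma occursAt_singleton {y : ℕ → Fin p} {a : Fin p} {k : ℕ} : OccursAt y [a] k ↔ y k = a := by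
  simp [OccursAt, wordOf, seqDrop]

/-- The words which occur at some position not smaller than `J`. -/
def wordsFrom (y : ℕ → Fin p) (J : ℕ) (u : List (Fin p)) : Prop := ∃ k ≥ J, OccursAt y u k

/-- The words which occur infinitely often. -/
def recurrentWords (y : ℕ → Fin p) (u : List (Fin p)) : Prop := ∃ᶠ k in atTop, OccursAt y u k

lemma of_isInfix_wordsFrom (y : ℕ → Fin p) (J : ℕ) (b c : List (Fin p)) (h : b <:+: c)
    (hc : wordsFrom y J c) : wordsFrom y J b := by
  obtain ⟨s, t, rfl⟩ := h
  obtain ⟨k, hk, ho⟩ := hc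
  exact ⟨k + s.length, by omega, (occursAt_append.1 (occursAt_append.1 ho).1).2⟩

lemma recurrentWords_iff {y : ℕ → Fin p} {u : List (Fin p)} :
    recurrentWords y u ↔ ∀ J, wordsFrom y J u := frequently_atTop

lemma isLanguage_recurrentWords (y : ℕ → Fin p) : IsLanguage (recurrentWords y) where
  of_factor b c h hc := by
    rw [recurrentWords_iff] at hc ⊢
    exact fun J => of_isInfix_wordsFrom y J b c h (hc J)
  extend u hu := by
    by_contra! hcon
    have h : ∀ᶠ k in atTop, ∀ a, ¬ OccursAt y (u ++ [a]) k :=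
      eventually_all.2 fun a => not_frequently.1 (hcon a)
    obtain ⟨k, hk, hk'⟩ := (hu.and_eventually h).exists
    exact hk' (y (k + u.length)) (occursAt_append.2 ⟨hk, occursAt_singleton.2 rfl⟩)

lemma recurrentWords_nil (y : ℕ → Fin p) : recurrentWords y [] :=
  recurrentWords_iff.2 fun J => ⟨J, le_rfl, rfl⟩

/-- Sequences that are periodic from some index on. -/
def IsEventuallyPeriodic {α : Type*} (y : ℕ → α) : Prop := ∃ q > 0, ∃ J, ∀ t ≥ J, y (t + q) = y t

lemma periodic_of_seqAppend_eq {α : Type*} {u : List α} {x : ℕ → α} (h : seqAppend u x = x) :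
    Function.Periodic x u.length := by
  have h1 := seqDrop_seqAppend u x
  rw [h] at h1
  exact fun t => congrFun h1 t

lemma Function.Periodic.of_seqDrop {α : Type*} {x : ℕ → α} {q q' k : ℕ}
    (h : Function.Periodic x q') (hq' : 0 < q') (hk : ∀ t ≥ k, x (t + q) = x t) :
    Function.Periodic x q := by
  intro t
  have h1 : Function.Periodic x (k * q') := by simpa using h.nsmul k
  rw [← h1 (t + q), ← h1 t, add_right_comm]
  exact hk _ (by nlinarith)

lemma isEventuallyPeriodic_of_forall_periodic {y e : ℕ → Fin p} {q : ℕ} (hq : 0 < q)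
    (he : Function.Periodic e q) (hey : e ∈ seqsOf (recurrentWords y))
    (h : ∀ i < q, ∀ a, seqCons a (seqDrop i e) ∈ seqsOf (recurrentWords y) → a = e (i + q - 1)) :
    IsEventuallyPeriodic y := by
  have h1 : ∀ i < q, ∀ a, ∃ n, a ≠ e (i + q - 1) →
      ¬ recurrentWords y (a :: wordOf (seqDrop i e) n) := by
    intro i hi a
    by_cases ha : a = e (i + q - 1)
    · exact ⟨0, fun h => absurd ha h⟩
    · by_contra! hcon
      refine ha (h i hi a fun n => ?_)
      have h2 := (hcon n).2
      rw [← wordOf_seqCons] at h2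
      exact (isLanguage_recurrentWords y).of_factor _ _ (wordOf_prefix_wordOf _ n.le_succ).isInfix h2
  choose! n hn using h1
  obtain ⟨N, hN⟩ : ∃ N, ∀ i < q, ∀ a, n i a ≤ N := by
    refine ⟨∑ i ∈ Finset.range q, ∑ a, n i a, fun i hi a => ?_⟩
    exact (Finset.single_le_sum (f := fun a => n i a) (fun _ _ => Nat.zero_le _)
      (Finset.mem_univ a)).trans (Finset.single_le_sum (f := fun i => ∑ a, n i a)
      (fun _ _ => Nat.zero_le _) (Finset.mem_range.2 hi))
  have h3 : ∀ᶠ k in atTop, ∀ i ∈ Finset.range q, ∀ a, a ≠ e (i + q - 1) →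
      ¬ OccursAt y (a :: wordOf (seqDrop i e) N) k := by
    refine (Filter.eventually_all_finset _).2 fun i hi => eventually_all.2 fun a => ?_
    by_cases ha : a = e (i + q - 1)
    · exact Eventually.of_forall fun _ h => absurd ha h
    · have h4 := not_frequently.1 (hn i (Finset.mem_range.1 hi) a ha)
      filter_upwards [h4] with k hk _ hocc
      apply hk
      have hpre : a :: wordOf (seqDrop i e) (n i a) <+: a :: wordOf (seqDrop i e) N := by
        rw [← wordOf_seqCons, ← wordOf_seqCons]
        exact wordOf_prefix_wordOf _ (Nat.succ_le_succ (hN i (Finset.mem_range.1 hi) a))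
      obtain ⟨t, ht⟩ := hpre
      rw [← ht] at hocc
      exact (occursAt_append.1 hocc).1
  obtain ⟨J, hJ⟩ := eventually_atTop.1 h3
  have hper : ∀ i, seqDrop (i % q) e = seqDrop i e := by
    intro i
    funext t
    have h5 : Function.Periodic e (i / q * q) := by simpa using he.nsmul (i / q)
    have h6 : t + i = t + i % q + i / q * q := by
      have := Nat.mod_add_div i q; rw [mul_comm] at this; omega
    simp only [seqDrop]
    rw [h6, h5]
  have hback : ∀ k ≥ J, ∀ i, OccursAt y (wordOf (seqDrop i e) N) (k + 1) →
      y k = e (i + q - 1) := by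
    intro k hk i ho
    by_contra hne
    have hmod : e (i % q + q - 1) = e (i + q - 1) := by
      have := congrFun (hper i) (q - 1)
      simp only [seqDrop] at this
      rw [show i % q + q - 1 = q - 1 + i % q by omega, this]
      congr 1; omega
    refine hJ k hk (i % q) (Finset.mem_range.2 (Nat.mod_lt _ hq)) (y k) (by rwa [hmod]) ?_
    rw [hper]
    exact (occursAt_append (u := [y k])).2 ⟨occursAt_singleton.2 rfl, ho⟩
  have hstep : ∀ k₀, OccursAt y (wordOf e N) k₀ → ∀ D, J + D ≤ k₀ →
      OccursAt y (wordOf (seqDrop (D * (q - 1)) e) N) (k₀ - D) := by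
    intro k₀ hk₀ D
    induction D with
    | zero =>
      intro _
      rw [zero_mul]
      exact hk₀
    | succ D ih =>
      intro hD
      have h7 := ih (by omega)
      rw [show k₀ - D = k₀ - (D + 1) + 1 by omega] at h7
      have h8 := hback _ (by omega) _ h7
      have h9 := (occursAt_append (u := [y (k₀ - (D + 1))])).2 ⟨occursAt_singleton.2 rfl, h7⟩
      have h10 : [y (k₀ - (D + 1))] ++ wordOf (seqDrop (D * (q - 1)) e) N =
          wordOf (seqDrop ((D + 1) * (q - 1)) e) (N + 1) := by
        rw [List.singleton_append, ← wordOf_seqCons]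
        congr 1
        funext t
        cases t with
        | zero =>
          simp only [seqCons, seqDrop, h8]
          congr 1
          rw [add_mul]; omega
        | succ t =>
          simp only [seqCons, seqDrop]
          rw [show t + 1 + (D + 1) * (q - 1) = t + D * (q - 1) + q by rw [add_mul]; omega, he]
      rw [h10, wordOf_succ] at h9
      exact (occursAt_append.1 h9).1
  refine ⟨q, hq, J, fun t ht => ?_⟩
  obtain ⟨k₀, hk₀, ho⟩ := recurrentWords_iff.1 (hey N) (t + q + 1)
  rw [OccursAt, length_wordOf] at ho
  have ho' : OccursAt y (wordOf e N) k₀ := by rw [OccursAt, length_wordOf]; exact ho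
  have a1 := hstep k₀ ho' (k₀ - (t + q) - 1) (by omega)
  have a2 := hstep k₀ ho' (k₀ - t - 1) (by omega)
  rw [show k₀ - (k₀ - (t + q) - 1) = t + q + 1 by omega] at a1
  rw [show k₀ - (k₀ - t - 1) = t + 1 by omega] at a2
  rw [hback _ (by omega) _ a1, hback _ ht _ a2]
  have h11 : Function.Periodic e ((q - 1) * q) := by simpa using he.nsmul (q - 1)
  rw [show (k₀ - t - 1) * (q - 1) + q - 1 = (k₀ - (t + q) - 1) * (q - 1) + q - 1 + (q - 1) * q from ?_,
    h11]
  rw [show k₀ - t - 1 = (k₀ - (t + q) - 1) + q by omega, add_mul, mul_comm q]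
  omega

lemma exists_aperiodic_extension {y e : ℕ → Fin p} (hy : ¬ IsEventuallyPeriodic y)
    (hey : e ∈ seqsOf (recurrentWords y)) :
    ∃ s, seqAppend s e ∈ seqsOf (recurrentWords y) ∧
      ∀ u, u ≠ [] → seqAppend u (seqAppend s e) ≠ seqAppend s e := by
  by_contra! hcon
  obtain ⟨u, hu, hue⟩ := hcon [] hey
  have hq : 0 < u.length := List.length_pos_iff.2 hu
  have he : Function.Periodic e u.length := periodic_of_seqAppend_eq hue
  refine hy (isEventuallyPeriodic_of_forall_periodic hq he hey fun i hi a ha => ?_)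
  have hdrop : seqDrop u.length e = e := funext he
  have h1 : seqCons a (seqDrop i e) =
      seqAppend (a :: wordOf (seqDrop i e) (u.length - i)) e := by
    rw [seqAppend]
    congr 1
    conv_lhs => rw [← seqAppend_wordOf (seqDrop i e) (u.length - i), ← seqDrop_add,
      Nat.sub_add_cancel hi.le, hdrop]
  rw [h1] at ha
  obtain ⟨u', hu', hue'⟩ := hcon _ ha
  have h2 : Function.Periodic (seqCons a (seqDrop i e)) u.length := by
    refine Function.Periodic.of_seqDrop (k := 1) (h1 ▸ periodic_of_seqAppend_eq hue')
      (List.length_pos_iff.2 hu') ?_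
    intro t ht
    obtain ⟨t, rfl⟩ := Nat.exists_eq_add_of_le' ht
    simp only [seqCons, seqDrop, show t + 1 + u.length = t + u.length + 1 by omega]
    rw [add_right_comm, he]
  have h3 := h2 0
  obtain ⟨q, hq'⟩ := Nat.exists_eq_add_of_lt hq
  rw [zero_add] at hq'
  rw [zero_add, hq'] at h3
  simp only [seqCons, seqDrop] at h3
  rw [← h3]
  congr 1; omega

lemma countable_isEventuallyPeriodic : {y : ℕ → Fin p | IsEventuallyPeriodic y}.Countable := by
  have h : {y : ℕ → Fin p | IsEventuallyPeriodic y} ⊆ ⋃ qJ : ℕ × ℕ,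
      {y | 0 < qJ.1 ∧ ∀ t ≥ qJ.2, y (t + qJ.1) = y t} := by
    rintro y ⟨q, hq, J, h⟩
    exact mem_iUnion.2 ⟨(q, J), hq, h⟩
  refine (countable_iUnion fun qJ => ?_).mono h
  have := Set.MapsTo.countable_of_injOn (f := fun y => wordOf y (qJ.2 + qJ.1))
    (s := {y : ℕ → Fin p | 0 < qJ.1 ∧ ∀ t ≥ qJ.2, y (t + qJ.1) = y t})
    (t := univ) (fun _ _ => mem_univ _) ?_ (Set.to_countable _)
  · exact this
  rintro y ⟨hq, hy⟩ z ⟨-, hz⟩ h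
  have h' := wordOf_eq_iff.1 h
  funext t
  induction t using Nat.strong_induction_on with
  | _ t ih =>
    by_cases ht : t < qJ.2 + qJ.1
    · exact h' t ht
    · have h1 := hy (t - qJ.1) (by omega)
      have h2 := hz (t - qJ.1) (by omega)
      rw [Nat.sub_add_cancel (by omega)] at h1 h2
      rw [h1, h2, ih _ (by omega)]

end Recurrence

namespace ExpansiveMarkovSystem

variable {p : ℕ} (S : ExpansiveMarkovSystem p)

lemma ae_finite_setOf_sumLen_le {v : List (Fin p)} (hv : v ≠ []) (C : ℝ) :
    ∀ᵐ x, {w : List (Fin p) | S.sumLen (S.cyl v) w ≤ C ∧ x ∈ S.cyl (w ++ v)}.Finite := by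
  refine ae_finite_setOfPred_mem (s := fun w => {x | S.sumLen (S.cyl v) w ≤ C ∧ x ∈ S.cyl (w ++ v)}) ?_
  have hg := S.volume_gap_pos hv
  set K := Real.exp (S.lip * C) * volume.real (S.cyl v) / volume.real (S.gap v) with hK
  have hK0 : 0 ≤ K := by positivity
  have h : ∀ w, volume {x | S.sumLen (S.cyl v) w ≤ C ∧ x ∈ S.cyl (w ++ v)} ≤
      ENNReal.ofReal K * volume (S.comp w '' S.gap v) := by
    intro w
    by_cases hw : S.sumLen (S.cyl v) w ≤ C
    · simp only [hw, true_and, ofPred_mem_eq]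
      have hfin : volume (S.comp w '' S.gap v) ≠ ⊤ := S.volume_ne_top
        ((S.image_comp_subset_dom w ((S.gap_subset v).trans (S.cyl_subset_dom hv))).trans
          S.dom_subset_I)
      rw [← ENNReal.ofReal_toReal hfin, ← ENNReal.ofReal_toReal
        (S.volume_ne_top (S.cyl_subset_I (w ++ v))), ← ENNReal.ofReal_mul hK0]
      apply ENNReal.ofReal_le_ofReal
      have h1 := S.volume_image_mul_le w (S.isPreconnected_cyl v) (S.cyl_subset_dom hv)
        (S.measurableSet_cyl v) subset_rfl (S.measurableSet_gap v) (S.gap_subset v)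
      rw [← S.cyl_append w hv] at h1
      change volume.real _ ≤ K * volume.real _
      rw [hK, div_mul_eq_mul_div, le_div_iff₀ hg]
      refine h1.trans ?_
      rw [mul_right_comm]
      gcongr
      exact S.lip_nonneg
    · simp [hw]
  refine ne_top_of_le_ne_top ?_ (ENNReal.tsum_le_tsum h)
  rw [ENNReal.tsum_mul_left]
  exact ENNReal.mul_ne_top ENNReal.ofReal_ne_top
    (ne_top_of_le_ne_top (S.volume_ne_top subset_rfl) (S.tsum_volume_image_gap_le hv))

lemma exists_sumLen_le_of_not_isEventuallyPeriodic {y : ℕ → Fin p}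
    (hy : ¬ IsEventuallyPeriodic y) : ∃ v, v ≠ [] ∧ recurrentWords y v ∧ ∃ J, ∃ C : ℝ,
      ∀ w, wordsFrom y J (w ++ v) → S.sumLen (S.cyl v) w ≤ C := by
  have hP := isLanguage_recurrentWords y
  obtain ⟨ζ₀, hζ₀, -⟩ := S.exists_mem_seqsOf hP (recurrentWords_nil y)
  obtain ⟨_, ⟨e, he, rfl⟩, hmin⟩ := (S.isCompact_image_seqsOf (recurrentWords y)).exists_isLeast
    ⟨_, mem_image_of_mem _ hζ₀⟩
  have hmin' : ∀ ζ ∈ seqsOf (recurrentWords y), S.pt e ≤ S.pt ζ :=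
    fun ζ hζ => hmin (mem_image_of_mem _ hζ)
  obtain ⟨s, hs, haper⟩ := exists_aperiodic_extension hy he
  have hlip := S.lip_nonneg
  obtain ⟨k₀, hk₀⟩ := S.exists_sumLen_le_of_isLeast hP hmin' s
    (η := Real.log (21 / 20) / (S.lip + 1)) (div_pos (Real.log_pos (by norm_num)) (by linarith))
  have hSM : ∀ n ≥ s.length + k₀ + 1, ∀ r, IsSimple r (wordOf (seqAppend s e) n) →
      recurrentWords y (r ++ wordOf (seqAppend s e) n) →
      Real.exp (S.lip * S.sumLen (S.cyl (wordOf (seqAppend s e) n)) r) ≤ 21 / 20 := by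
    intro n hn r hr hPr
    obtain ⟨k, rfl⟩ := Nat.exists_eq_add_of_le (show s.length ≤ n by omega)
    rw [wordOf_seqAppend] at hr hPr ⊢
    have h1 := hk₀ k (by omega) r hr hPr
    rw [le_div_iff₀ (by linarith)] at h1
    rw [← Real.le_log_iff_exp_le (by norm_num)]
    have h2 := S.sumLen_nonneg (S.cyl (s ++ wordOf e k)) r
    linarith
  rcases S.contracting_or_periodic hP.of_factor (seqAppend s e) (by omega) hSM with
    ⟨n, hn, hret⟩ | ⟨u, hu, hux⟩
  swap
  · exact absurd hux (haper u hu.1.ne_nil)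
  set v := wordOf (seqAppend s e) n with hv
  have hvne : v ≠ [] := wordOf_ne_nil _ (by omega)
  have hVpos := S.volume_cyl_pos v
  set K := Real.exp (S.lip * volume.real S.I) with hK
  have hKpos : 0 < K := Real.exp_pos _
  obtain ⟨N, hN⟩ := S.exists_volume_cyl_lt (ε := volume.real (S.cyl v) / (2 * K)) (by positivity)
  have hJ : ∀ᶠ k in atTop, ∀ c ∈ {c : List (Fin p) | c.length < N}, ¬ recurrentWords y c →
      ¬ OccursAt y c k := by
    refine (eventually_all_finite (List.finite_length_lt (Fin p) N)).2 fun c _ => ?_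
    by_cases hc : recurrentWords y c
    · exact Eventually.of_forall fun _ h => absurd hc h
    · filter_upwards [not_frequently.1 hc] with k hk _ using hk
  obtain ⟨J, hJ⟩ := eventually_atTop.1 hJ
  refine ⟨v, hvne, hs n, J, ?_⟩
  refine S.sumLen_le_of_contracting_returns (of_isInfix_wordsFrom y J) hvne
    (l := 189 / 200) (by norm_num) fun u hu hPu x hx => ?_
  by_cases hlen : (u ++ v).length < N
  · refine hret u hu ?_ x hx
    by_contra hnot
    obtain ⟨k, hk, ho⟩ := hPu
    exact hJ k hk _ hlen hnot ho
  · have h1 := S.abs_der_mul_volume_le u (S.isPreconnected_cyl v) (S.cyl_subset_dom hvne) hx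
      (S.measurableSet_cyl v) subset_rfl
    rw [← S.cyl_append u hvne] at h1
    have h2 := hN (u ++ v) (not_lt.1 hlen)
    have h3 : Real.exp (S.lip * S.sumLen (S.cyl v) u) ≤ K :=
      Real.exp_le_exp.2 (mul_le_mul_of_nonneg_left (S.sumLen_cyl_le_I hvne hu.simple) hlip)
    rw [lt_div_iff₀ (by positivity)] at h2
    have h4 : |S.der u x| * volume.real (S.cyl v) ≤ 1 / 2 * volume.real (S.cyl v) := by
      refine h1.trans ?_
      have := mul_le_mul_of_nonneg_right h3 (measureReal_nonneg (μ := volume) (s := S.cyl (u ++ v)))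
      linarith
    have h5 := le_of_mul_le_mul_right h4 hVpos
    linarith

lemma volume_range_pt : volume (range S.pt) = 0 := by
  have hae : ∀ᵐ x, ∀ v : {v : List (Fin p) // v ≠ []}, ∀ C : ℕ,
      {w : List (Fin p) | S.sumLen (S.cyl v) w ≤ C ∧ x ∈ S.cyl (w ++ v)}.Finite :=
    ae_all_iff.2 fun v => ae_all_iff.2 fun C => S.ae_finite_setOf_sumLen_le v.2 C
  have h1 : range S.pt ⊆ S.pt '' {y | IsEventuallyPeriodic y} ∪
      {x | ¬ ∀ v : {v : List (Fin p) // v ≠ []}, ∀ C : ℕ,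
        {w : List (Fin p) | S.sumLen (S.cyl v) w ≤ C ∧ x ∈ S.cyl (w ++ v)}.Finite} := by
    rintro _ ⟨y, rfl⟩
    by_cases hy : IsEventuallyPeriodic y
    · exact Or.inl (mem_image_of_mem _ hy)
    refine Or.inr fun hfin => ?_
    obtain ⟨v, hv, hrec, J, C, hC⟩ := S.exists_sumLen_le_of_not_isEventuallyPeriodic hy
    obtain ⟨C', hC'⟩ := exists_nat_ge (J * volume.real S.I + C)
    have hinf : {k | J ≤ k ∧ OccursAt y v k}.Infinite := by
      rw [← Nat.frequently_atTop_iff_infinite]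
      exact (hrec.and_eventually (eventually_ge_atTop J)).mono fun k hk => ⟨hk.2, hk.1⟩
    refine hinf (Set.Finite.of_finite_image (f := wordOf y) ((hfin ⟨v, hv⟩ C').subset ?_) ?_)
    · rintro _ ⟨k, ⟨hJk, ho⟩, rfl⟩
      have hmem : wordOf y (k + v.length) = wordOf y k ++ v := by rw [wordOf_add, ho]
      refine ⟨?_, hmem ▸ S.pt_mem y _⟩
      obtain ⟨j, rfl⟩ := Nat.exists_eq_add_of_le hJk
      rw [wordOf_add, sumLen_append]
      have hd := S.cyl_subset_dom hv
      have a1 := S.sumLen_le_length_mul (wordOf y J)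
        (S.image_comp_subset_dom (wordOf (seqDrop J y) j) hd)
      rw [length_wordOf] at a1
      have a2 := hC (wordOf (seqDrop J y) j) ⟨J, le_rfl, occursAt_append.2
        ⟨occursAt_wordOf y J j, by simpa using ho⟩⟩
      show _ + S.sumLen (S.cyl v) _ ≤ _
      linarith
    · intro k _ k' _ h
      simpa using congrArg List.length h
  refine measure_mono_null h1 (measure_union_null ?_ hae)
  exact (countable_isEventuallyPeriodic.image _).measure_zero _

lemma tendsto_volume_levelSet : Tendsto (fun n => volume.real (S.levelSet n)) atTop (nhds 0) := by
  have h := tendsto_measure_iInter_atTop (μ := volume) (s := S.levelSet)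
    (fun n => (S.isCompact_levelSet n).measurableSet.nullMeasurableSet)
    (fun m n h => S.levelSet_anti h) ⟨0, S.volume_ne_top (S.levelSet_subset_I 0)⟩
  rw [measure_mono_null S.iInter_levelSet_subset S.volume_range_pt] at h
  exact (ENNReal.tendsto_toReal ENNReal.zero_ne_top).comp h

end ExpansiveMarkovSystem

lemma isClosed_setOf_wordOf {p : ℕ} (P : List (Fin p) → Prop) (n : ℕ) :
    IsClosed {ω : ℕ → Fin p | P (wordOf ω n)} := by
  have h : Continuous fun (ω : ℕ → Fin p) (i : Fin n) => ω i :=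
    continuous_pi fun i => continuous_apply _
  have h2 := (isClosed_discrete {x : Fin n → Fin p | P (List.ofFn x)}).preimage h
  convert h2 using 1
  ext ω
  have : wordOf ω n = List.ofFn fun i : Fin n => ω i := by
    apply List.ext_getElem <;> simp [wordOf]
  simp [this]

lemma eq_of_seqAppend_eq {p : ℕ} {u : List (Fin p)} (hu : u ≠ []) {ω ζ : ℕ → Fin p}
    (h : seqAppend u ω = ω) (h' : seqAppend u ζ = ζ) : ω = ζ := by
  have h1 : wordOf ω u.length = wordOf ζ u.length := by
    conv_lhs => rw [← h, wordOf_seqAppend_length]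
    conv_rhs => rw [← h', wordOf_seqAppend_length]
  funext t
  rw [← (periodic_of_seqAppend_eq h).map_mod_nat t, ← (periodic_of_seqAppend_eq h').map_mod_nat t]
  exact wordOf_eq_iff.1 h1 _ (Nat.mod_lt _ (List.length_pos_iff.2 hu))

namespace ExpansiveMarkovSystem

variable {p : ℕ} (S : ExpansiveMarkovSystem p)

/-- The words whose cylinders have uniformly bounded total length under all branches. -/
def IsGood (v : List (Fin p)) : Prop := ∃ C : ℝ, ∀ w, S.sumLen (S.cyl v) w ≤ C

variable {S} in
lemma IsGood.append_right {v : List (Fin p)} (h : S.IsGood v) (hv : v ≠ []) (t : List (Fin p)) :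
    S.IsGood (v ++ t) := by
  obtain ⟨C, hC⟩ := h
  exact ⟨C, fun w => (S.sumLen_mono (S.cyl_append_subset v t) (S.cyl_subset_dom hv) w).trans (hC w)⟩

variable {S} in
lemma IsGood.append_left {v : List (Fin p)} (h : S.IsGood v) (hv : v ≠ []) (t : List (Fin p)) :
    S.IsGood (t ++ v) := by
  obtain ⟨C, hC⟩ := h
  refine ⟨C, fun w => ?_⟩
  have h1 := hC (w ++ t)
  rw [sumLen_append, ← S.cyl_append t hv] at h1
  linarith [S.sumLen_nonneg (S.cyl v) t]

/-- The sequences none of whose nonempty finite prefixes is good. -/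
def badSeqs : Set (ℕ → Fin p) := {ω | ∀ n, n ≠ 0 → ¬ S.IsGood (wordOf ω n)}

variable {S} in
lemma seqDrop_mem_badSeqs {ω : ℕ → Fin p} (h : ω ∈ S.badSeqs) (k : ℕ) :
    seqDrop k ω ∈ S.badSeqs := by
  intro n hn hg
  refine h (k + n) (by omega) ?_
  rw [wordOf_add]
  exact hg.append_left (wordOf_ne_nil _ hn) _

lemma exists_forall_mem_badSeqs : ∃ n₀, n₀ ≠ 0 ∧ ∀ ω ∈ S.badSeqs,
    ∃ u, S.IsNoncontracting u (wordOf ω n₀) ∧ seqAppend u ω = ω := by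
  have hlip := S.lip_nonneg
  have hε : 0 < Real.log (21 / 20) / (S.lip + 1) :=
    div_pos (Real.log_pos (by norm_num)) (by linarith)
  obtain ⟨n₀, hn₀⟩ := eventually_atTop.1 (S.tendsto_volume_levelSet.eventually_lt_const hε)
  refine ⟨n₀ + 1, by omega, fun ω hω => ?_⟩
  have hSM : ∀ n ≥ n₀ + 1, ∀ r, IsSimple r (wordOf ω n) → True →
      Real.exp (S.lip * S.sumLen (S.cyl (wordOf ω n)) r) ≤ 21 / 20 := by
    intro n hn r hr _
    have h1 := S.sumLen_cyl_le_levelSet (wordOf_ne_nil ω (show n ≠ 0 by omega)) hr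
    have h2 := hn₀ n (by omega)
    rw [length_wordOf] at h1
    rw [lt_div_iff₀ (by linarith)] at h2
    rw [← Real.le_log_iff_exp_le (by norm_num)]
    have h3 := S.sumLen_nonneg (S.cyl (wordOf ω n)) r
    have h4 := mul_le_mul_of_nonneg_left h1 hlip
    have h5 : 0 ≤ volume.real (S.levelSet n) := measureReal_nonneg
    linarith
  rcases S.contracting_or_periodic (P := fun _ => True) (fun _ _ _ _ => trivial) ω
    (n₀ := n₀ + 1) (by omega) hSM with ⟨n, hn, hret⟩ | h
  · exfalso
    have hne := wordOf_ne_nil ω (show n ≠ 0 by omega)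
    obtain ⟨C, hC⟩ := S.sumLen_le_of_contracting_returns (P := fun _ => True)
      (fun _ _ _ _ => trivial) hne (by norm_num) hret
    exact hω n (by omega) ⟨C, fun w => hC w trivial⟩
  · exact h

lemma exists_injOn_badSeqs : ∃ n₀, InjOn (fun ω => wordOf ω n₀) S.badSeqs := by
  obtain ⟨n₀, hn₀, h⟩ := S.exists_forall_mem_badSeqs
  refine ⟨n₀, fun ω hω ζ hζ heq => ?_⟩
  obtain ⟨u, hu, huω⟩ := h ω hω
  obtain ⟨u', hu', huζ⟩ := h ζ hζ
  simp only at heq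
  rw [← heq] at hu'
  rw [IsNoncontracting.unique S hu' hu] at huζ
  exact eq_of_seqAppend_eq hu.1.ne_nil huω huζ

lemma finite_badSeqs : S.badSeqs.Finite := by
  obtain ⟨n₀, h⟩ := S.exists_injOn_badSeqs
  refine Set.Finite.of_injOn (t := {w : List (Fin p) | w.length = n₀}) ?_ h
    (finite_words n₀)
  intro ω _; simp

lemma exists_common_period : ∃ m > 0, ∀ e ∈ S.badSeqs,
    seqDrop m e = e ∧ 0 < S.der (wordOf e m) (S.pt e) := by
  obtain ⟨n₀, hn₀, h⟩ := S.exists_forall_mem_badSeqs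
  have h1 : ∀ e ∈ S.badSeqs, ∃ q > 0, Function.Periodic e q := by
    intro e he
    obtain ⟨u, hu, hue⟩ := h e he
    exact ⟨u.length, List.length_pos_iff.2 hu.1.ne_nil, periodic_of_seqAppend_eq hue⟩
  choose! q hq hper using h1
  set M := ∏ e ∈ S.finite_badSeqs.toFinset, q e with hM
  have hMpos : 0 < M := Finset.prod_pos fun e he => hq e (by simpa using he)
  refine ⟨M + M, by omega, fun e he => ?_⟩
  obtain ⟨k, hk⟩ : q e ∣ M := Finset.dvd_prod_of_mem q (by simpa using he)
  have hperM : Function.Periodic e M := by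
    rw [hk, mul_comm]; simpa using (hper e he).nsmul k
  have hdrop : seqDrop M e = e := funext hperM
  have hpt : S.comp (wordOf e M) (S.pt e) = S.pt e := by
    rw [comp_pt]
    conv_rhs => rw [← seqAppend_wordOf e M, hdrop]
  refine ⟨by rw [seqDrop_add, hdrop, hdrop], ?_⟩
  rw [wordOf_add, hdrop, der_append, hpt]
  exact mul_self_pos.2 (S.der_ne_zero _ (S.pt_mem_dom e))

lemma exists_isGood_or_near (N : ℕ) : ∃ M ≥ N, M ≠ 0 ∧ ∀ ω : ℕ → Fin p,
    S.IsGood (wordOf ω M) ∨ ∃ e ∈ S.badSeqs, wordOf ω N = wordOf e N := by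
  by_contra! hcon
  set K : ℕ → Set (ℕ → Fin p) := fun M => {ω | ¬ S.IsGood (wordOf ω (N + 1 + M))} ∩
    {ω | ∀ e ∈ S.badSeqs, wordOf ω N ≠ wordOf e N} with hK
  have hcl : ∀ M, IsClosed (K M) := fun M =>
    (isClosed_setOf_wordOf (fun w => ¬ S.IsGood w) _).inter
      (isClosed_setOf_wordOf (fun w => ∀ e ∈ S.badSeqs, w ≠ wordOf e N) N)
  have hne : (⋂ M, K M).Nonempty := by
    apply IsCompact.nonempty_iInter_of_sequence_nonempty_isCompact_isClosed
    · rintro M ω ⟨h1, h2⟩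
      refine ⟨fun hg => h1 ?_, h2⟩
      rw [show N + 1 + (M + 1) = N + 1 + M + 1 by omega, wordOf_succ]
      exact hg.append_right (wordOf_ne_nil _ (by omega)) _
    · intro M
      obtain ⟨ω, hω⟩ := hcon (N + 1 + M) (by omega) (by omega)
      exact ⟨ω, hω.1, hω.2⟩
    · exact (hcl 0).isCompact
    · exact hcl
  obtain ⟨ω, hω⟩ := hne
  rw [mem_iInter] at hω
  have hbad : ω ∈ S.badSeqs := by
    intro n hn hg
    refine (hω n).1 ?_
    rw [show N + 1 + n = n + (N + 1) by omega, wordOf_add]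
    exact hg.append_right (wordOf_ne_nil _ hn) _
  exact (hω 0).2 ω hbad rfl

end ExpansiveMarkovSystem

lemma abs_log_le_mul_abs_sub_one {a t : ℝ} (ha : 0 < a) (hat : a ≤ t) :
    |Real.log t| ≤ (1 + 1 / a) * |t - 1| := by
  have ht : 0 < t := ha.trans_le hat
  have h0 : 0 ≤ 1 / a := by positivity
  have habs := abs_nonneg (t - 1)
  rw [abs_le]
  constructor
  · have h1 := Real.log_le_sub_one_of_pos (inv_pos.2 ht)
    rw [Real.log_inv] at h1
    have h2 : t⁻¹ - 1 ≤ 1 / a * |t - 1| := by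
      have h3 : t⁻¹ - 1 = 1 / t * (1 - t) := by field_simp
      rw [h3]
      calc 1 / t * (1 - t) ≤ 1 / t * |t - 1| := by
            gcongr
            rw [abs_sub_comm]; exact le_abs_self _
        _ ≤ 1 / a * |t - 1| := by gcongr
    nlinarith
  · have h1 := Real.log_le_sub_one_of_pos ht
    have h2 := le_abs_self (t - 1)
    nlinarith [mul_nonneg h0 habs]

lemma exists_deriv_eq_slope_uIcc {φ : ℝ → ℝ} {a b : ℝ}
    (h : ∀ x ∈ uIcc a b, DifferentiableAt ℝ φ x) :
    ∃ ξ ∈ uIcc a b, φ b - φ a = deriv φ ξ * (b - a) := by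
  have key : ∀ {a b : ℝ}, a < b → (∀ x ∈ Icc a b, DifferentiableAt ℝ φ x) →
      ∃ ξ ∈ Icc a b, φ b - φ a = deriv φ ξ * (b - a) := by
    intro a b hab h
    obtain ⟨ξ, hξ, he⟩ := exists_deriv_eq_slope φ hab
      (fun x hx => (h x hx).continuousAt.continuousWithinAt)
      (fun x hx => (h x (Ioo_subset_Icc_self hx)).differentiableWithinAt)
    refine ⟨ξ, Ioo_subset_Icc_self hξ, ?_⟩
    rw [he, div_mul_cancel₀ _ (by linarith)]
  rcases lt_trichotomy a b with hab | rfl | hab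
  · rw [uIcc_of_le hab.le] at h ⊢
    exact key hab h
  · exact ⟨a, left_mem_uIcc, by simp⟩
  · rw [uIcc_of_ge hab.le] at h ⊢
    obtain ⟨ξ, hξ, he⟩ := key hab h
    exact ⟨ξ, hξ, by linarith⟩

lemma AnalyticAt.eventually_abs_mul_deriv_le {ψ : ℝ → ℝ} {e : ℝ} (h : AnalyticAt ℝ ψ e)
    (h0 : ¬ ∀ᶠ z in nhds e, ψ z = 0) :
    ∃ L : ℝ, 0 ≤ L ∧ ∀ᶠ z in nhds e, |z - e| * |deriv ψ z| ≤ L * |ψ z| ∧ (z ≠ e → ψ z ≠ 0) := by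
  obtain ⟨n, g, hg, hge, hψ⟩ := h.exists_eventuallyEq_pow_smul_nonzero_iff.2 h0
  refine ⟨n + 1, by positivity, ?_⟩
  have hgne : ∀ᶠ z in nhds e, g z ≠ 0 := hg.continuousAt.eventually_ne hge
  have hcont : ContinuousAt (fun z => |z - e| * |deriv g z| / |g z|) e := by
    refine ContinuousAt.div (ContinuousAt.mul (by fun_prop) hg.deriv.continuousAt.abs)
      hg.continuousAt.abs (by simpa using hge)
  have hsmall : ∀ᶠ z in nhds e, |z - e| * |deriv g z| / |g z| < 1 :=
    hcont.eventually_lt_const (by simp)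
  filter_upwards [hgne, hsmall, hψ.eventually_nhds, hg.eventually_analyticAt] with z h1 h2 h3 h4
  have hz : ψ z = (z - e) ^ n * g z := by simpa using h3.self_of_nhds
  have hd : deriv ψ z = n * (z - e) ^ (n - 1) * g z + (z - e) ^ n * deriv g z := by
    rw [Filter.EventuallyEq.deriv_eq h3]
    have := ((((hasDerivAt_id z).sub_const e).fun_pow n).fun_mul h4.differentiableAt.hasDerivAt)
    simpa using this.deriv
  constructor
  · rw [← abs_mul, hd, hz]
    have h5 : (z - e) * (n * (z - e) ^ (n - 1) * g z + (z - e) ^ n * deriv g z) =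
        (z - e) ^ n * (n * g z + (z - e) * deriv g z) := by
      rcases n with _ | n
      · simp
      · simp only [Nat.add_sub_cancel]; ring
    rw [h5, abs_mul, abs_mul, mul_left_comm]
    gcongr
    rw [div_lt_one (abs_pos.2 h1), ← abs_mul] at h2
    refine (abs_add_le _ _).trans ?_
    rw [abs_mul, Nat.abs_cast]
    linarith
  · intro hne
    rw [hz]
    exact mul_ne_zero (pow_ne_zero _ (sub_ne_zero.2 hne)) h1

/-- Orbits converging to a fixed point of an analytic map with positive multiplier have
summable derivatives, with a bound controlled by the nonlinearity at the starting point. -/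
lemma AnalyticAt.exists_sum_deriv_mul_log_le {φ : ℝ → ℝ} {e : ℝ} (ha : AnalyticAt ℝ φ e)
    (hd : 0 < deriv φ e) :
    ∃ δ > 0, ∃ C : ℝ, ∀ x : ℕ → ℝ, (∀ j, x (j + 1) = φ (x j)) → (∀ j, |x j - e| < δ) →
      Tendsto x atTop (nhds e) → x 0 ≠ e → ∀ n,
      (∑ j ∈ Finset.range n, ∏ i ∈ Finset.range j, deriv φ (x i)) *
        |Real.log (deriv φ (x 0))| ≤ C := by
  by_cases h0 : ∀ᶠ z in nhds e, φ z - z = 0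
  · obtain ⟨δ, hδ, hball⟩ := Metric.eventually_nhds_iff.1 h0
    refine ⟨δ, hδ, 0, fun x hx hxδ hlim hne => ?_⟩
    exfalso
    have hconst : ∀ j, x j = x 0 := by
      intro j
      induction j with
      | zero => rfl
      | succ j ih =>
        have := hball (y := x j) (hxδ j)
        rw [hx j]; linarith
    have h1 : Tendsto x atTop (nhds (x 0)) := by
      rw [show x = fun _ => x 0 from funext hconst]; exact tendsto_const_nhds
    exact hne (tendsto_nhds_unique h1 hlim)
  have hψ : AnalyticAt ℝ (fun z => φ z - z) e := ha.sub analyticAt_id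
  obtain ⟨L, hL, hψL⟩ := hψ.eventually_abs_mul_deriv_le h0
  have hderiv := ha.deriv
  obtain ⟨θ, t, ht, hθ⟩ := ((hderiv.contDiffAt (n := 1)).log hd.ne').exists_lipschitzOnWith
  set a := deriv φ e / 2 with hadef
  have hapos : 0 < a := by positivity
  have haev : ∀ᶠ z in nhds e, a < deriv φ z :=
    hderiv.continuousAt.eventually_const_lt (by linarith)
  obtain ⟨δ, hδ, hball⟩ := Metric.eventually_nhds_iff.1
    (hψL.and (haev.and (ha.eventually_analyticAt.and ht)))
  refine ⟨δ, hδ, Real.exp (θ * δ) * ((1 + 1 / a) * L), fun x hx hxδ hlim hne n => ?_⟩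
  set d : ℕ → ℝ := fun j => x j - x (j + 1) with hddef
  have hmem : ∀ j, x j ∈ ball e δ := fun j => hxδ j
  have hseg : ∀ j, uIcc (x j) (x (j + 1)) ⊆ ball e δ := fun j =>
    (convex_ball e δ).ordConnected.uIcc_subset (hmem j) (hmem (j + 1))
  have hstep : ∀ j, ∃ c, deriv φ (x j) * Real.exp (-(θ * |d j|)) ≤ c ∧ d (j + 1) = c * d j := by
    intro j
    obtain ⟨ξ, hξ, hξe⟩ := exists_deriv_eq_slope_uIcc (φ := φ) (a := x j) (b := x (j + 1))
      fun z hz => (hball (hseg j hz)).2.2.1.differentiableAt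
    refine ⟨deriv φ ξ, ?_, ?_⟩
    · have hξb := hball (hseg j hξ)
      have hjb := hball (hmem j)
      have h1 := hθ.dist_le_mul _ hjb.2.2.2 _ hξb.2.2.2
      simp only [Real.dist_eq] at h1
      have h2 : |x j - ξ| ≤ |d j| := by
        rw [abs_sub_comm, hddef]
        simp only
        rw [abs_sub_comm (x j)]
        exact abs_sub_left_of_mem_uIcc hξ
      have h3 : Real.log (deriv φ (x j)) - θ * |d j| ≤ Real.log (deriv φ ξ) := by
        have h4 := (abs_le.1 h1).2
        have h5 : (θ : ℝ) * |x j - ξ| ≤ θ * |d j| := by gcongr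
        linarith
      rw [← Real.exp_log (hapos.trans hjb.2.1), ← Real.exp_log (hapos.trans hξb.2.1),
        ← Real.exp_add]
      exact Real.exp_le_exp.2 (by linarith)
    · simp only [hddef]
      rw [hx (j + 1)]
      nth_rewrite 1 [hx j]
      linarith
  choose c hc hdc using hstep
  have hder : ∀ j, 0 < deriv φ (x j) := fun j => hapos.trans (hball (hmem j)).2.1
  have hcpos : ∀ j, 0 < c j := fun j => (mul_pos (hder j) (Real.exp_pos _)).trans_le (hc j)
  have hx0 := hball (hmem 0)
  have hd0 : d 0 ≠ 0 := by
    have := hx0.1.2 hne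
    simp only [hddef, hx 0]
    intro h; apply this; linarith
  have hsum : ∀ n, ∑ j ∈ Finset.range n, |d j| ≤ |x 0 - e| := by
    have habs : ∀ j, |d j| = SignType.sign (d 0) * d j := by
      intro j
      have hs : SignType.sign (d j) = SignType.sign (d 0) := by
        induction j with
        | zero => rfl
        | succ j ih => rw [hdc j, sign_mul, sign_pos (hcpos j), one_mul, ih]
      rw [← hs, sign_mul_self]
    have htel : ∀ n, ∑ j ∈ Finset.range n, |d j| = SignType.sign (d 0) * (x 0 - x n) := by
      intro n
      simp_rw [habs]
      rw [← Finset.mul_sum]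
      congr 1
      rw [← neg_inj, ← Finset.sum_neg_distrib]
      simp only [hddef, neg_sub]
      exact Finset.sum_range_sub x n
    have hmono : Monotone fun n => ∑ j ∈ Finset.range n, |d j| := fun m n h =>
      Finset.sum_le_sum_of_subset_of_nonneg (Finset.range_mono h) fun _ _ _ => abs_nonneg _
    have hl : Tendsto (fun n => ∑ j ∈ Finset.range n, |d j|) atTop
        (nhds (SignType.sign (d 0) * (x 0 - e))) := by
      simp_rw [htel]
      exact (hlim.const_sub _).const_mul _
    intro n
    refine (hmono.ge_of_tendsto hl n).trans ?_
    refine (le_abs_self _).trans ?_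
    rw [abs_mul]
    refine mul_le_of_le_one_left (abs_nonneg _) ?_
    rcases lt_trichotomy (d 0) 0 with h | h | h
    · simp [sign_neg h]
    · simp [h]
    · simp [sign_pos h]
  have hD : ∀ n, (∏ i ∈ Finset.range n, deriv φ (x i)) * |d 0| ≤
      Real.exp (θ * ∑ j ∈ Finset.range n, |d j|) * |d n| := by
    intro n
    induction n with
    | zero => simp
    | succ n ih =>
      rw [Finset.prod_range_succ, Finset.sum_range_succ, mul_add, Real.exp_add, hdc n, abs_mul,
        abs_of_pos (hcpos n)]
      have h1 : deriv φ (x n) ≤ Real.exp (θ * |d n|) * c n := by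
        have h2 := mul_le_mul_of_nonneg_left (hc n) (Real.exp_pos (θ * |d n|)).le
        rwa [mul_left_comm, ← Real.exp_add, add_neg_cancel, Real.exp_zero, mul_one] at h2
      calc (∏ i ∈ Finset.range n, deriv φ (x i)) * deriv φ (x n) * |d 0|
          = (∏ i ∈ Finset.range n, deriv φ (x i)) * |d 0| * deriv φ (x n) := by ring
        _ ≤ (Real.exp (θ * ∑ j ∈ Finset.range n, |d j|) * |d n|) *
            (Real.exp (θ * |d n|) * c n) := mul_le_mul ih h1 (hder n).le (by positivity)
        _ = _ := by ring
  have hS : (∑ j ∈ Finset.range n, ∏ i ∈ Finset.range j, deriv φ (x i)) * |d 0| ≤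
      Real.exp (θ * δ) * |x 0 - e| := by
    rw [Finset.sum_mul]
    have h1 : ∀ j ∈ Finset.range n, (∏ i ∈ Finset.range j, deriv φ (x i)) * |d 0| ≤
        Real.exp (θ * δ) * |d j| := fun j _ => (hD j).trans (by
      gcongr
      exact (hsum j).trans (hxδ 0).le)
    refine (Finset.sum_le_sum h1).trans ?_
    rw [← Finset.mul_sum]
    gcongr
    exact hsum n
  set T := ∑ j ∈ Finset.range n, ∏ i ∈ Finset.range j, deriv φ (x i) with hT
  have hT0 : 0 ≤ T := Finset.sum_nonneg fun j _ => Finset.prod_nonneg fun i _ => (hder i).le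
  have hlog := abs_log_le_mul_abs_sub_one hapos hx0.2.1.le
  have hψd : deriv (fun z => φ z - z) (x 0) = deriv φ (x 0) - 1 := by
    rw [deriv_fun_sub hx0.2.2.1.differentiableAt differentiableAt_fun_id]; simp
  have h1 := hx0.1.1
  rw [hψd] at h1
  have h2 : |φ (x 0) - x 0| = |d 0| := by rw [abs_sub_comm, ← hx 0]
  rw [h2] at h1
  have hxe : 0 < |x 0 - e| := abs_pos.2 (sub_ne_zero.2 hne)
  refine le_of_mul_le_mul_right ?_ hxe
  calc T * |Real.log (deriv φ (x 0))| * |x 0 - e|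
      ≤ T * ((1 + 1 / a) * |deriv φ (x 0) - 1|) * |x 0 - e| := by gcongr
    _ = T * (1 + 1 / a) * (|x 0 - e| * |deriv φ (x 0) - 1|) := by ring
    _ ≤ T * (1 + 1 / a) * (L * |d 0|) := by gcongr
    _ = (1 + 1 / a) * L * (T * |d 0|) := by ring
    _ ≤ (1 + 1 / a) * L * (Real.exp (θ * δ) * |x 0 - e|) := by gcongr
    _ = _ := by ring

namespace ExpansiveMarkovSystem

variable {p : ℕ} (S : ExpansiveMarkovSystem p)

lemma comp_mem_interior_dom (w : List (Fin p)) {x : ℝ} (hx : x ∈ interior S.dom) :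
    S.comp w x ∈ interior S.dom := by
  cases w with
  | nil => exact hx
  | cons i w =>
    exact interior_mono (S.isub_subset_dom i)
      (S.g_mem_interior i (S.comp_mem_dom w (interior_subset hx)))

lemma comp_analyticAt (han : ∀ i, AnalyticOn ℝ (S.g i) S.dom) (w : List (Fin p)) {x : ℝ}
    (hx : x ∈ interior S.dom) : AnalyticAt ℝ (S.comp w) x := by
  induction w with
  | nil => exact analyticAt_id
  | cons i w ih =>
    exact AnalyticAt.comp (g := S.g i) ((han i).analyticAt
      (mem_interior_iff_mem_nhds.1 (S.comp_mem_interior_dom w hx))) ih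

lemma deriv_comp (w : List (Fin p)) {x : ℝ} (hx : x ∈ interior S.dom) :
    deriv (S.comp w) x = S.der w x :=
  ((S.comp_hasDerivWithinAt w (interior_subset hx)).hasDerivAt
    (mem_interior_iff_mem_nhds.1 hx)).deriv

/-- The absolute multiplier of the branch `w` at the point coded by `ω`. -/
noncomputable def absDer (w : List (Fin p)) (ω : ℕ → Fin p) : ℝ := |S.der w (S.pt ω)|

lemma absDer_pos (w : List (Fin p)) (ω : ℕ → Fin p) : 0 < S.absDer w ω :=
  S.abs_der_pos w (S.pt_mem_dom ω)

lemma absDer_nil (ω : ℕ → Fin p) : S.absDer [] ω = 1 := by simp [absDer]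

lemma absDer_append (u v : List (Fin p)) (ω : ℕ → Fin p) :
    S.absDer (u ++ v) ω = S.absDer u (seqAppend v ω) * S.absDer v ω := by
  rw [absDer, der_append, abs_mul, comp_pt]; rfl

lemma wordOf_iterate_seqAppend {u : List (Fin p)} {e ω : ℕ → Fin p} {N : ℕ}
    (hu : seqAppend u e = e) (h : wordOf ω N = wordOf e N) (j : ℕ) :
    wordOf ((seqAppend u)^[j] ω) (j * u.length + N) = wordOf e (j * u.length + N) := by
  induction j with
  | zero => simpa using h
  | succ j ih =>
    rw [Function.iterate_succ_apply', show (j + 1) * u.length + N = u.length + (j * u.length + N)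
      by ring, wordOf_seqAppend, ih, ← wordOf_seqAppend, hu]

lemma exists_sum_absDer_mul_log_le (han : ∀ i, AnalyticOn ℝ (S.g i) S.dom) {u : List (Fin p)}
    (hu0 : u ≠ []) {e : ℕ → Fin p} (hu : seqAppend u e = e) (hpos : 0 < S.der u (S.pt e)) :
    ∃ N, ∃ C : ℝ, ∀ ω, wordOf ω N = wordOf e N → ω ≠ e → ∀ n,
      (∑ j ∈ Finset.range n, ∏ i ∈ Finset.range j, S.absDer u ((seqAppend u)^[i] ω)) *
        |Real.log (S.absDer u ω)| ≤ C := by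
  have hx₀ := S.pt_mem_interior_dom e
  obtain ⟨δ, hδ, C, hC⟩ := (S.comp_analyticAt han u hx₀).exists_sum_deriv_mul_log_le
    (by rwa [S.deriv_comp u hx₀])
  have hcont : ContinuousAt (S.der u) (S.pt e) :=
    (S.der_continuousOn u).continuousAt (mem_interior_iff_mem_nhds.1 hx₀)
  obtain ⟨δ', hδ', hball⟩ := Metric.eventually_nhds_iff.1 (hcont.eventually (lt_mem_nhds hpos))
  obtain ⟨N, hN⟩ := S.exists_volume_cyl_lt (lt_min hδ hδ')
  refine ⟨N, C, fun ω hω hne n => ?_⟩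
  set o : ℕ → ℕ → Fin p := fun j => (seqAppend u)^[j] ω with ho
  have hnear : ∀ j, |S.pt (o j) - S.pt e| ≤
      volume.real (S.cyl (wordOf e (j * u.length + N))) := fun j =>
    S.abs_sub_le_volume_cyl (by
      rw [← wordOf_iterate_seqAppend hu hω j]; exact S.pt_mem _ _) (S.pt_mem _ _)
  have hlt : ∀ j, |S.pt (o j) - S.pt e| < min δ δ' := fun j =>
    (hnear j).trans_lt (hN _ (by simp))
  have hder : ∀ j, deriv (S.comp u) (S.pt (o j)) = S.absDer u (o j) := fun j => by
    rw [S.deriv_comp u (S.pt_mem_interior_dom _), absDer, abs_of_pos]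
    exact hball (by rw [Real.dist_eq]; exact (hlt j).trans_le (min_le_right _ _))
  have := hC (fun j => S.pt (o j)) (fun j => by
      rw [comp_pt]; simp only [ho, Function.iterate_succ_apply'])
    (fun j => (hlt j).trans_le (min_le_left _ _)) ?_ (fun h => hne (S.pt_injective h)) n
  · simp only [hder] at this
    exact this
  · rw [Metric.tendsto_atTop]
    intro ε hε
    obtain ⟨K, hK⟩ := S.exists_volume_cyl_lt hε
    refine ⟨K, fun j hj => ?_⟩
    rw [Real.dist_eq]
    refine (hnear j).trans_lt (hK _ ?_)
    have : 1 ≤ u.length := List.length_pos_iff.2 hu0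
    rw [length_wordOf]
    nlinarith

/-- The words of length `n`. -/
noncomputable def words (p n : ℕ) : Finset (List (Fin p)) :=
  (List.finite_length_eq (Fin p) n).toFinset

lemma mem_words {n : ℕ} {w : List (Fin p)} : w ∈ words p n ↔ w.length = n := by
  simp [words]

lemma sum_words_add (a b : ℕ) (f : List (Fin p) → ℝ) :
    ∑ w ∈ words p (a + b), f w = ∑ v ∈ words p b, ∑ u ∈ words p a, f (u ++ v) := by
  rw [← Finset.sum_product']
  refine (Finset.sum_bij (fun x _ => x.2 ++ x.1) ?_ ?_ ?_ ?_).symm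
  · rintro ⟨v, u⟩ h
    simp only [Finset.mem_product, mem_words] at h
    simp [mem_words, h]
  · rintro ⟨v, u⟩ h ⟨v', u'⟩ h' heq
    simp only [Finset.mem_product, mem_words] at h h'
    obtain ⟨h1, h2⟩ := List.append_inj heq (h.2.trans h'.2.symm)
    rw [Prod.mk.injEq]
    exact ⟨h2, h1⟩
  · intro w hw
    rw [mem_words] at hw
    refine ⟨(w.drop a, w.take a), ?_, by simp⟩
    simp only [Finset.mem_product, mem_words]
    simp [hw]
  · intros; rfl

/-- Partial sums of the Poincaré series of exponent `s` over words of length divisible by `m`. -/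
noncomputable def poincare (m : ℕ) (s : ℝ) (n : ℕ) (ω : ℕ → Fin p) : ℝ :=
  ∑ j ∈ Finset.range n, ∑ w ∈ words p (j * m), S.absDer w ω ^ s

lemma poincare_zero (m : ℕ) (s : ℝ) (ω : ℕ → Fin p) : S.poincare m s 0 ω = 0 := by
  simp [poincare]

lemma poincare_succ (m : ℕ) (s : ℝ) (n : ℕ) (ω : ℕ → Fin p) :
    S.poincare m s (n + 1) ω =
      1 + ∑ w ∈ words p m, S.absDer w ω ^ s * S.poincare m s n (seqAppend w ω) := by
  have h0 : words p 0 = {[]} := by ext; simp [mem_words]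
  rw [poincare, Finset.sum_range_succ', zero_mul, h0, Finset.sum_singleton, absDer_nil,
    Real.one_rpow, add_comm]
  congr 1
  simp only [poincare, Finset.mul_sum]
  rw [Finset.sum_comm]
  refine Finset.sum_congr rfl fun j _ => ?_
  rw [add_mul, one_mul, sum_words_add]
  refine Finset.sum_congr rfl fun v _ => Finset.sum_congr rfl fun u _ => ?_
  rw [absDer_append, Real.mul_rpow (S.absDer_pos _ _).le (S.absDer_pos _ _).le, mul_comm]

lemma poincare_nonneg (m : ℕ) (s : ℝ) (n : ℕ) (ω : ℕ → Fin p) : 0 ≤ S.poincare m s n ω :=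
  Finset.sum_nonneg fun _ _ => Finset.sum_nonneg fun _ _ => Real.rpow_nonneg (S.absDer_pos _ _).le _

lemma poincare_mono (m : ℕ) (s : ℝ) (ω : ℕ → Fin p) : Monotone fun n => S.poincare m s n ω :=
  monotone_nat_of_le_succ fun n => by
    simp only [poincare, Finset.sum_range_succ]
    exact le_add_of_nonneg_right
      (Finset.sum_nonneg fun _ _ => Real.rpow_nonneg (S.absDer_pos _ _).le _)

variable {S} in
lemma IsGood.exists_poincare_le {v : List (Fin p)} (h : S.IsGood v) (hv : v ≠ []) {m : ℕ}
    (hm : 0 < m) : ∃ K : ℝ, ∀ ω, wordOf ω v.length = v → ∀ n, S.poincare m 1 n ω ≤ K := by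
  obtain ⟨C, hC⟩ := h
  have hgap := S.volume_gap_pos hv
  refine ⟨Real.exp (S.lip * C) * volume.real S.I / volume.real (S.gap v), fun ω hω n => ?_⟩
  have hptv : S.pt ω ∈ S.cyl v := by
    have := S.pt_mem ω v.length
    rwa [hω] at this
  have hd := S.cyl_subset_dom hv
  have hdisj : ((Finset.range n : Finset ℕ) : Set ℕ).PairwiseDisjoint
      (fun j => words p (j * m)) := fun i _ j _ hij => Finset.disjoint_left.2 fun w h1 h2 => by
    rw [mem_words] at h1 h2
    exact hij (Nat.eq_of_mul_eq_mul_right hm (h1.symm.trans h2))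
  have hsum : S.poincare m 1 n ω =
      ∑ w ∈ (Finset.range n).biUnion fun j => words p (j * m), S.absDer w ω := by
    rw [Finset.sum_biUnion hdisj]
    simp [poincare]
  rw [hsum, le_div_iff₀ hgap, Finset.sum_mul]
  generalize (Finset.range n).biUnion (fun j => words p (j * m)) = F
  have hvol : ∑ w ∈ F, volume.real (S.comp w '' S.gap v) ≤ volume.real S.I := by
    have h1 := (ENNReal.sum_le_tsum F).trans (S.tsum_volume_image_gap_le hv)
    have hne : ∀ w ∈ F, volume (S.comp w '' S.gap v) ≠ ⊤ := fun w _ =>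
      S.volume_ne_top ((S.image_comp_subset_dom w ((S.gap_subset v).trans hd)).trans
        S.dom_subset_I)
    have h2 := ENNReal.toReal_mono (S.volume_ne_top subset_rfl) h1
    rwa [ENNReal.toReal_sum hne] at h2
  calc ∑ w ∈ F, S.absDer w ω * volume.real (S.gap v)
      ≤ ∑ w ∈ F, Real.exp (S.lip * C) * volume.real (S.comp w '' S.gap v) := by
        refine Finset.sum_le_sum fun w _ => ?_
        refine (S.abs_der_mul_volume_le w (S.isPreconnected_cyl v) hd hptv
          (S.measurableSet_gap v) (S.gap_subset v)).trans ?_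
        have := S.lip_nonneg
        gcongr
        exact hC w
    _ ≤ _ := by rw [← Finset.mul_sum]; gcongr

variable {S} in
/-- The words of length `m` have uniformly bounded multipliers. -/
lemma exists_absDer_le (w : List (Fin p)) : ∃ L : ℝ, ∀ ω, S.absDer w ω ≤ L ∧
    |Real.log (S.absDer w ω)| ≤ L := by
  have hc := S.isCompact_dom
  have h1 := (S.der_continuousOn w).abs
  obtain ⟨L₁, hL₁⟩ := hc.exists_bound_of_continuousOn h1
  obtain ⟨L₂, hL₂⟩ := hc.exists_bound_of_continuousOn
    (h1.log fun x hx => (S.abs_der_pos w hx).ne')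
  refine ⟨max L₁ L₂, fun ω => ⟨?_, ?_⟩⟩
  · have := hL₁ _ (S.pt_mem_dom ω)
    rw [Real.norm_eq_abs, abs_abs] at this
    exact this.trans (le_max_left _ _)
  · exact (hL₂ _ (S.pt_mem_dom ω)).trans (le_max_right _ _)

lemma exists_words_absDer_le (m : ℕ) : ∃ L : ℝ, 0 ≤ L ∧ ∀ w ∈ words p m, ∀ ω, S.absDer w ω ≤ L ∧
    |Real.log (S.absDer w ω)| ≤ L := by
  choose L hL using fun w : List (Fin p) => exists_absDer_le (S := S) w
  refine ⟨∑ w ∈ words p m, |L w|, by positivity, fun w hw ω => ?_⟩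
  have : L w ≤ ∑ w ∈ words p m, |L w| :=
    (le_abs_self _).trans (Finset.single_le_sum (f := fun w => |L w|) (fun _ _ => abs_nonneg _) hw)
  exact ⟨(hL w ω).1.trans this, (hL w ω).2.trans this⟩

lemma exists_poincare_le_of_isGood {M m : ℕ} (hM : M ≠ 0) (hm : 0 < m) :
    ∃ K : ℝ, 0 ≤ K ∧ ∀ ω, S.IsGood (wordOf ω M) → ∀ n, S.poincare m 1 n ω ≤ K := by
  have h : ∀ w : List (Fin p), ∃ K : ℝ, S.IsGood w → w ≠ [] → ∀ ω, wordOf ω w.length = w →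
      ∀ n, S.poincare m 1 n ω ≤ K := fun w => by
    by_cases hw : S.IsGood w ∧ w ≠ []
    · obtain ⟨K, hK⟩ := hw.1.exists_poincare_le hw.2 hm
      exact ⟨K, fun _ _ => hK⟩
    · exact ⟨0, fun h1 h2 => (hw ⟨h1, h2⟩).elim⟩
  choose K hK using h
  refine ⟨∑ w ∈ words p M, |K w|, by positivity, fun ω hω n => ?_⟩
  have hw : wordOf ω M ∈ words p M := by simp [mem_words]
  exact ((hK _ hω (wordOf_ne_nil ω hM) ω (by simp) n).trans (le_abs_self _)).trans
    (Finset.single_le_sum (f := fun w => |K w|) (fun _ _ => abs_nonneg _) hw)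

lemma absDer_mul_poincare_le (m n : ℕ) {w : List (Fin p)} (hw : w ∈ words p m) (ω : ℕ → Fin p) :
    S.absDer w ω * S.poincare m 1 n (seqAppend w ω) ≤ S.poincare m 1 (n + 1) ω := by
  rw [poincare_succ]
  have := Finset.single_le_sum
    (f := fun w => S.absDer w ω ^ (1 : ℝ) * S.poincare m 1 n (seqAppend w ω))
    (fun w _ => mul_nonneg (Real.rpow_nonneg (S.absDer_pos _ _).le _) (S.poincare_nonneg _ _ _ _)) hw
  simp only [Real.rpow_one] at this ⊢
  linarith

/-- The terms of the Poincaré series of exponent one, weighted by the logarithm of the first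
multiplier, are bounded uniformly away from the exceptional sequences. -/
lemma exists_absDer_mul_poincare_mul_log_le (han : ∀ i, AnalyticOn ℝ (S.g i) S.dom) {m : ℕ}
    (hm : 0 < m) (hper : ∀ e ∈ S.badSeqs, seqDrop m e = e ∧ 0 < S.der (wordOf e m) (S.pt e)) :
    ∃ C : ℝ, 0 ≤ C ∧ ∀ ω ∉ S.badSeqs, ∀ w ∈ words p m, ∀ n,
      S.absDer w ω * S.poincare m 1 n (seqAppend w ω) * |Real.log (S.absDer w ω)| ≤ C := by
  obtain ⟨n₀, hn₀⟩ := S.exists_injOn_badSeqs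
  have hfix : ∀ e ∈ S.badSeqs, seqAppend (wordOf e m) e = e := fun e he => by
    conv_rhs => rw [← seqAppend_wordOf e m, (hper e he).1]
  have hR := fun e he => S.exists_sum_absDer_mul_log_le han (wordOf_ne_nil e hm.ne') (hfix e he)
    (hper e he).2
  choose! N C hNC using hR
  set B := S.finite_badSeqs.toFinset with hB
  have hmemB : ∀ e, e ∈ B ↔ e ∈ S.badSeqs := fun e => by simp [hB]
  set N₀ := n₀ + ∑ e ∈ B, N e with hN₀
  set C₀ := ∑ e ∈ B, |C e| with hC₀
  obtain ⟨M, -, hM, hdich⟩ := S.exists_isGood_or_near (m + N₀)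
  obtain ⟨K, hK0, hK⟩ := S.exists_poincare_le_of_isGood hM hm
  obtain ⟨L, hL0, hL⟩ := S.exists_words_absDer_le m
  have key : ∀ ω : ℕ → Fin p, ∀ w ∈ words p m, ∀ e ∈ S.badSeqs,
      wordOf (seqAppend w ω) (m + N₀) = wordOf e (m + N₀) →
      w = wordOf e m ∧ wordOf ω N₀ = wordOf e N₀ := by
    intro ω w hw e he h
    rw [mem_words] at hw
    rw [wordOf_add e, (hper e he).1, ← hw, wordOf_seqAppend, hw] at h
    exact List.append_inj h (by simp [hw])
  set C' := 1 + (words p m).card * (L * K) with hC'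
  have hC'1 : 0 ≤ C' := by positivity
  have claim : ∀ e ∈ S.badSeqs, ∀ n, ∀ ζ : ℕ → Fin p, wordOf ζ N₀ = wordOf e N₀ →
      S.poincare m 1 n ζ ≤ C' * ∑ k ∈ Finset.range n, ∏ i ∈ Finset.range k,
        S.absDer (wordOf e m) ((seqAppend (wordOf e m))^[i] ζ) := by
    intro e he n
    set u := wordOf e m with hu
    have hul : u.length = m := by simp [hu]
    have humem : u ∈ words p m := mem_words.2 hul
    induction n with
    | zero => intro ζ _; simp [poincare_zero]
    | succ n ih =>
      intro ζ hζ
      have hstep : S.poincare m 1 (n + 1) ζ ≤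
          C' + S.absDer u ζ * S.poincare m 1 n (seqAppend u ζ) := by
        rw [poincare_succ]
        have hterm : ∀ w ∈ words p m, S.absDer w ζ ^ (1 : ℝ) * S.poincare m 1 n (seqAppend w ζ) ≤
            L * K + if w = u then S.absDer u ζ * S.poincare m 1 n (seqAppend u ζ) else 0 := by
          intro w hw
          rw [Real.rpow_one]
          split_ifs with hwu
          · subst hwu
            have : 0 ≤ L * K := by positivity
            linarith
          · rcases hdich (seqAppend w ζ) with hg | ⟨e', he', hne⟩
            · rw [add_zero]
              exact mul_le_mul (hL w hw ζ).1 (hK _ hg n) (S.poincare_nonneg _ _ _ _) hL0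
            · exfalso
              obtain ⟨h1, h2⟩ := key ζ w hw e' he' hne
              have : e' = e := hn₀ he' he
                (wordOf_eq_of_le (Nat.le_add_right _ _) (h2.symm.trans hζ))
              exact hwu (h1.trans (by rw [this]))
        refine (add_le_add_right (Finset.sum_le_sum hterm) _).trans ?_
        rw [Finset.sum_add_distrib, Finset.sum_ite_eq' _ u, if_pos humem, Finset.sum_const,
          nsmul_eq_mul, ← add_assoc]
      have hnear : wordOf (seqAppend u ζ) N₀ = wordOf e N₀ := by
        have h := wordOf_iterate_seqAppend (hfix e he) hζ 1
        exact wordOf_eq_of_le (Nat.le_add_left _ _) h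
      refine hstep.trans ?_
      rw [Finset.sum_range_succ', Finset.prod_range_zero, mul_add, mul_one, add_comm]
      refine add_le_add ?_ le_rfl
      refine (mul_le_mul_of_nonneg_left (ih _ hnear) (S.absDer_pos _ _).le).trans_eq ?_
      simp only [Finset.prod_range_succ', Function.iterate_succ_apply, Function.iterate_zero,
        id_eq]
      rw [← Finset.sum_mul]
      ring
  have hC₀0 : 0 ≤ C₀ := by positivity
  refine ⟨L * K * L + C' * C₀, by positivity, fun ω hω w hw n => ?_⟩
  rcases hdich (seqAppend w ω) with hg | ⟨e, he, hne⟩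
  · have h1 : S.absDer w ω * S.poincare m 1 n (seqAppend w ω) * |Real.log (S.absDer w ω)| ≤
        L * K * L := by
      have := S.poincare_nonneg m 1 n (seqAppend w ω)
      gcongr
      · exact (hL w hw ω).1
      · exact hK _ hg n
      · exact (hL w hw ω).2
    have : 0 ≤ C' * C₀ := by positivity
    linarith
  · obtain ⟨rfl, h2⟩ := key ω w hw e he hne
    have hle : N e ≤ N₀ := (Finset.single_le_sum (f := N) (fun _ _ => Nat.zero_le _)
      ((hmemB e).2 he)).trans (Nat.le_add_left _ _)
    have h3 := hNC e he ω (wordOf_eq_of_le hle h2) (fun h => hω (h ▸ he)) (n + 1)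
    have h4 : C e ≤ C₀ := (le_abs_self _).trans
      (Finset.single_le_sum (f := fun e => |C e|) (fun _ _ => abs_nonneg _) ((hmemB e).2 he))
    have h5 := (S.absDer_mul_poincare_le m n hw ω).trans (claim e he (n + 1) ω h2)
    have : 0 ≤ L * K * L := by positivity
    calc _ ≤ C' * _ * |Real.log (S.absDer (wordOf e m) ω)| := by gcongr
      _ = C' * (_ * |Real.log (S.absDer (wordOf e m) ω)|) := mul_assoc _ _ _
      _ ≤ C' * C₀ := by gcongr; exact h3.trans h4
      _ ≤ _ := by linarith

lemma seqAppend_notMem_badSeqs {ω : ℕ → Fin p} (hω : ω ∉ S.badSeqs) (w : List (Fin p)) :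
    seqAppend w ω ∉ S.badSeqs := fun h => hω (by
  have := S.seqDrop_mem_badSeqs h w.length
  rwa [seqDrop_seqAppend] at this)

lemma bddAbove_poincare {m : ℕ} (hm : 0 < m) {ω : ℕ → Fin p} (hω : ω ∉ S.badSeqs) :
    BddAbove (range fun n => S.poincare m 1 n ω) := by
  have h : ∃ n ≠ 0, S.IsGood (wordOf ω n) := by
    by_contra! h
    exact hω h
  obtain ⟨n, hn, hg⟩ := h
  obtain ⟨K, -, hK⟩ := S.exists_poincare_le_of_isGood hn hm
  exact ⟨K, by rintro _ ⟨k, rfl⟩; exact hK ω hg k⟩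

lemma rpow_le_mul_one_add_log {x L ε : ℝ} (hx : 0 < x) (hε : 0 ≤ ε) (hε1 : ε ≤ 1)
    (hL : |Real.log x| ≤ L) :
    x ^ (1 - ε) ≤ x + ε * Real.exp L * (x * |Real.log x|) := by
  set t := ε * |Real.log x| with ht
  have ht0 : 0 ≤ t := by positivity
  have h1 : Real.exp t ≤ 1 + t * Real.exp t := by
    have h2 := Real.add_one_le_exp (-t)
    have h3 : Real.exp (-t) * Real.exp t = 1 := by rw [← Real.exp_add]; simp
    nlinarith [Real.exp_pos t]
  have h4 : Real.exp t ≤ Real.exp L := Real.exp_le_exp.2 (by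
    have := abs_nonneg (Real.log x)
    nlinarith)
  have h5 : x ^ (1 - ε) ≤ x * Real.exp t := by
    rw [Real.rpow_def_of_pos hx]
    conv => rhs; rw [← Real.exp_log hx, ← Real.exp_add]
    refine Real.exp_le_exp.2 ?_
    have := neg_abs_le (Real.log x)
    nlinarith
  calc x ^ (1 - ε) ≤ x * Real.exp t := h5
    _ ≤ x * (1 + t * Real.exp L) := by
      gcongr
      exact h1.trans (by gcongr)
    _ = _ := by rw [ht]; ring

/-- The Poincaré series has a finite exponent smaller than one. -/
lemma exists_poincare_le (han : ∀ i, AnalyticOn ℝ (S.g i) S.dom) {m : ℕ} (hm : 0 < m)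
    (hper : ∀ e ∈ S.badSeqs, seqDrop m e = e ∧ 0 < S.der (wordOf e m) (S.pt e)) :
    ∃ s : ℝ, 0 ≤ s ∧ s < 1 ∧ ∀ ω ∉ S.badSeqs, ∃ K : ℝ, ∀ n, S.poincare m s n ω ≤ K := by
  obtain ⟨C, hC0, hC⟩ := S.exists_absDer_mul_poincare_mul_log_le han hm hper
  obtain ⟨L, hL0, hL⟩ := S.exists_words_absDer_le m
  set A := Real.exp L * C * (words p m).card with hA
  have hA0 : 0 ≤ A := by positivity
  set ε : ℝ := 1 / (2 * (A + 1)) with hε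
  have hε0 : 0 < ε := by positivity
  have hεA : 2 * ε * A ≤ 1 := by
    rw [hε, mul_one_div, div_mul_eq_mul_div, div_le_one (by positivity)]
    linarith
  have hε1 : ε ≤ 1 := by
    rw [hε, div_le_one (by positivity)]; linarith
  set H : (ℕ → Fin p) → ℝ := fun ω => ⨆ n, S.poincare m 1 n ω with hH
  have hlim : ∀ ω ∉ S.badSeqs, Tendsto (fun n => S.poincare m 1 n ω) atTop (nhds (H ω)) :=
    fun ω hω => tendsto_atTop_ciSup (S.poincare_mono m 1 ω) (S.bddAbove_poincare hm hω)
  have hHeq : ∀ ω ∉ S.badSeqs,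
      H ω = 1 + ∑ w ∈ words p m, S.absDer w ω * H (seqAppend w ω) := by
    intro ω hω
    have h1 := (hlim ω hω).comp (tendsto_add_atTop_nat 1)
    have h2 : Tendsto (fun n => 1 + ∑ w ∈ words p m,
        S.absDer w ω * S.poincare m 1 n (seqAppend w ω)) atTop
        (nhds (1 + ∑ w ∈ words p m, S.absDer w ω * H (seqAppend w ω))) :=
      tendsto_const_nhds.add (tendsto_finsetSum _ fun w _ =>
        (hlim _ (S.seqAppend_notMem_badSeqs hω w)).const_mul _)
    refine tendsto_nhds_unique h1 (h2.congr fun n => ?_)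
    simp [poincare_succ]
  have hHC : ∀ ω ∉ S.badSeqs, ∀ w ∈ words p m,
      S.absDer w ω * H (seqAppend w ω) * |Real.log (S.absDer w ω)| ≤ C := fun ω hω w hw =>
    le_of_tendsto' (((hlim _ (S.seqAppend_notMem_badSeqs hω w)).const_mul _).mul_const _)
      fun n => hC ω hω w hw n
  have hH0 : ∀ ω, 0 ≤ H ω := fun ω => Real.iSup_nonneg fun n => S.poincare_nonneg _ _ _ _
  refine ⟨1 - ε, by linarith, by linarith, fun ω hω => ⟨2 * H ω, fun n => ?_⟩⟩
  induction n generalizing ω with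
  | zero => rw [poincare_zero]; have := hH0 ω; positivity
  | succ n ih =>
    have hterm : ∀ w ∈ words p m,
        S.absDer w ω ^ (1 - ε) * S.poincare m (1 - ε) n (seqAppend w ω) ≤
        2 * (S.absDer w ω * H (seqAppend w ω)) + 2 * ε * (Real.exp L * C) := by
      intro w hw
      have h1 := ih _ (S.seqAppend_notMem_badSeqs hω w)
      have h2 := rpow_le_mul_one_add_log (S.absDer_pos w ω) hε0.le hε1 (hL w hw ω).2
      have h3 := hHC ω hω w hw
      have h4 := hH0 (seqAppend w ω)
      have h5 := S.poincare_nonneg m (1 - ε) n (seqAppend w ω)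
      calc _ ≤ (S.absDer w ω + ε * Real.exp L * (S.absDer w ω * |Real.log (S.absDer w ω)|)) *
            (2 * H (seqAppend w ω)) :=
            mul_le_mul h2 h1 h5 (le_trans (Real.rpow_nonneg (S.absDer_pos _ _).le _) h2)
        _ = 2 * (S.absDer w ω * H (seqAppend w ω)) + 2 * ε * (Real.exp L *
            (S.absDer w ω * H (seqAppend w ω) * |Real.log (S.absDer w ω)|)) := by ring
        _ ≤ _ := by gcongr
    rw [poincare_succ]
    have h1 := Finset.sum_le_sum hterm
    rw [Finset.sum_add_distrib, ← Finset.mul_sum, Finset.sum_const, nsmul_eq_mul] at h1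
    have h2 := hHeq ω hω
    have h3 : ((words p m).card : ℝ) * (2 * ε * (Real.exp L * C)) = 2 * ε * A := by
      rw [hA]; ring
    linarith

lemma ediam_cyl (w : List (Fin p)) : ediam (S.cyl w) = ENNReal.ofReal (volume.real (S.cyl w)) := by
  rw [← S.diam_cyl, Metric.diam, ENNReal.ofReal_toReal (S.isCompact_cyl w).isBounded.ediam_ne_top]

lemma tendsto_iSup_ediam_cyl :
    Tendsto (fun n : ℕ => ⨆ w : {w : List (Fin p) // n ≤ w.length}, ediam (S.cyl w))
      atTop (nhds 0) := by
  rw [ENNReal.tendsto_atTop_zero]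
  intro ε hε
  have hε' : 0 < (min ε 1).toReal := ENNReal.toReal_pos (by positivity) (by simp)
  obtain ⟨N, hN⟩ := S.exists_volume_cyl_lt hε'
  refine ⟨N, fun n hn => iSup_le fun w => ?_⟩
  rw [ediam_cyl]
  refine (ENNReal.ofReal_le_ofReal (hN w (hn.trans w.2)).le).trans ?_
  rw [ENNReal.ofReal_toReal (by simp)]
  exact min_le_left _ _

/-- The points visiting the cylinder of `v` at infinitely many multiples of the time `m`. -/
def recurrentSet (m : ℕ) (v : List (Fin p)) : Set ℝ :=
  {x | ∃ᶠ j in atTop, ∃ w ∈ words p (j * m), x ∈ S.cyl (w ++ v)}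

variable {S} in
lemma IsGood.exists_volume_cyl_append_le {v : List (Fin p)} (h : S.IsGood v) (hv : v ≠ []) :
    ∃ A : ℝ, 0 ≤ A ∧ ∀ ω, wordOf ω v.length = v → ∀ w,
      volume.real (S.cyl (w ++ v)) ≤ A * S.absDer w ω := by
  obtain ⟨C, hC⟩ := h
  refine ⟨Real.exp (S.lip * C) * volume.real (S.cyl v), by positivity, fun ω hω w => ?_⟩
  have hptv : S.pt ω ∈ S.cyl v := by
    have := S.pt_mem ω v.length
    rwa [hω] at this
  rw [S.cyl_append w hv]
  refine (S.volume_le_abs_der_mul w (S.isPreconnected_cyl v) (S.cyl_subset_dom hv) hptv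
    (S.measurableSet_cyl v) subset_rfl).trans ?_
  rw [mul_right_comm]
  have := S.lip_nonneg
  have := S.absDer_pos w ω
  change _ ≤ _ * S.absDer w ω
  change _ * _ * S.absDer w ω ≤ _
  gcongr
  exact hC w

lemma dimH_recurrentSet_le {m : ℕ} (hm : 0 < m) {v : List (Fin p)} (hv : v ≠ [])
    (hg : S.IsGood v) {s K : ℝ} (hs : 0 ≤ s) {ω : ℕ → Fin p} (hω : wordOf ω v.length = v)
    (hK : ∀ n, S.poincare m s n ω ≤ K) : dimH (S.recurrentSet m v) ≤ s.toNNReal := by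
  obtain ⟨A, hA, hAv⟩ := hg.exists_volume_cyl_append_le hv
  set c : ℕ → ENNReal := fun j => ∑ w ∈ words p (j * m), ediam (S.cyl (w ++ v)) ^ s with hc
  have hcj : ∀ j, c j ≤ ENNReal.ofReal (A ^ s * ∑ w ∈ words p (j * m), S.absDer w ω ^ s) := by
    intro j
    rw [Finset.mul_sum, ENNReal.ofReal_sum_of_nonneg fun w _ =>
      mul_nonneg (Real.rpow_nonneg hA _) (Real.rpow_nonneg (S.absDer_pos _ _).le _)]
    refine Finset.sum_le_sum fun w _ => ?_
    rw [ediam_cyl, ENNReal.ofReal_rpow_of_nonneg measureReal_nonneg hs,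
      ← Real.mul_rpow hA (S.absDer_pos _ _).le]
    exact ENNReal.ofReal_le_ofReal
      (Real.rpow_le_rpow measureReal_nonneg (hAv ω hω w) hs)
  have hctop : ∑' j, c j ≠ ⊤ := by
    refine ne_top_of_le_ne_top (ENNReal.ofReal_ne_top (r := A ^ s * K))
      (ENNReal.tsum_le_of_sum_range_le fun n => ?_)
    refine (Finset.sum_le_sum fun j _ => hcj j).trans ?_
    rw [← ENNReal.ofReal_sum_of_nonneg fun j _ => mul_nonneg (Real.rpow_nonneg hA _)
      (Finset.sum_nonneg fun w _ => Real.rpow_nonneg (S.absDer_pos _ _).le _), ← Finset.mul_sum]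
    exact ENNReal.ofReal_le_ofReal
      (mul_le_mul_of_nonneg_left (hK n) (Real.rpow_nonneg hA _))
  have hmeas := Measure.hausdorffMeasure_le_liminf_tsum (ι := fun n => Σ j : ℕ, words p ((j + n) * m))
    s (S.recurrentSet m v) _ S.tendsto_iSup_ediam_cyl
    (fun n i => S.cyl (i.2.1 ++ v))
    (Eventually.of_forall fun n i => le_iSup_of_le (f := fun w : {w : List (Fin p) // n ≤ w.length} =>
      ediam (S.cyl w)) ⟨i.2.1 ++ v, by
        have := mem_words.1 i.2.2
        rw [List.length_append, this]
        nlinarith [Nat.zero_le i.1]⟩ le_rfl)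
    (Eventually.of_forall fun n x hx => by
      obtain ⟨j, hj, w, hw, hxw⟩ := frequently_atTop.1 hx n
      obtain ⟨k, rfl⟩ := Nat.exists_eq_add_of_le' hj
      exact mem_iUnion.2 ⟨⟨k, w, hw⟩, hxw⟩)
  have hsum : ∀ n, ∑' i : Σ j : ℕ, words p ((j + n) * m), ediam (S.cyl (i.2.1 ++ v)) ^ s =
      ∑' j, c (j + n) := fun n => by
    rw [ENNReal.tsum_sigma']
    refine tsum_congr fun j => ?_
    exact Finset.tsum_subtype (words p ((j + n) * m)) fun w => ediam (S.cyl (w ++ v)) ^ s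
  simp only [hsum] at hmeas
  rw [(ENNReal.tendsto_sum_nat_add c hctop).liminf_eq] at hmeas
  refine dimH_le_of_hausdorffMeasure_ne_top ?_
  rw [Real.coe_toNNReal s hs]
  exact (hmeas.trans_lt ENNReal.zero_lt_top).ne

lemma countable_setOf_seqDrop_mem_badSeqs (m : ℕ) :
    {ω | ∃ j, seqDrop (j * m) ω ∈ S.badSeqs}.Countable := by
  refine (Countable.image2 (countable_univ (α := List (Fin p))) S.finite_badSeqs.countable
    seqAppend).mono ?_
  rintro ω ⟨j, hj⟩
  exact ⟨_, mem_univ _, _, hj, seqAppend_wordOf ω (j * m)⟩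

/-- Every sequence either is eventually exceptional, or has good words of a fixed length at
infinitely many multiples of `m`. -/
lemma exists_frequently_isGood {m : ℕ} (hm : 0 < m)
    (hper : ∀ e ∈ S.badSeqs, seqDrop m e = e) :
    ∃ M ≠ 0, ∀ ω : ℕ → Fin p, (∃ j, seqDrop (j * m) ω ∈ S.badSeqs) ∨
      ∃ᶠ j in atTop, S.IsGood (wordOf (seqDrop (j * m) ω) M) := by
  obtain ⟨n₀, hn₀⟩ := S.exists_injOn_badSeqs
  obtain ⟨M, -, hM, hdich⟩ := S.exists_isGood_or_near (m + n₀)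
  refine ⟨M, hM, fun ω => or_iff_not_imp_right.2 fun hfreq => ?_⟩
  rw [not_frequently, eventually_atTop] at hfreq
  obtain ⟨J, hJ⟩ := hfreq
  have hnear : ∀ k, ∃ e ∈ S.badSeqs,
      wordOf (seqDrop ((J + k) * m) ω) (m + n₀) = wordOf e (m + n₀) := fun k =>
    (hdich _).resolve_left (hJ _ (Nat.le_add_right _ _))
  choose e he hne using hnear
  have hsplit : ∀ k, wordOf (seqDrop ((J + k) * m) ω) m = wordOf (e k) m ∧
      wordOf (seqDrop ((J + (k + 1)) * m) ω) n₀ = wordOf (e k) n₀ := fun k => by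
    have h := hne k
    rw [wordOf_add, wordOf_add (e k), hper _ (he k), ← seqDrop_add,
      show m + (J + k) * m = (J + (k + 1)) * m by ring] at h
    exact List.append_inj h (by simp)
  have hconst : ∀ k, e k = e 0 := fun k => by
    induction k with
    | zero => rfl
    | succ k ih =>
      rw [← ih]
      exact hn₀ (he _) (he _)
        ((wordOf_eq_of_le (Nat.le_add_left n₀ m) (hne (k + 1))).symm.trans (hsplit k).2)
  have hpref : ∀ k, wordOf (seqDrop (J * m) ω) (k * m) = wordOf (e 0) (k * m) := fun k => by
    induction k with
    | zero => simp [wordOf_zero]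
    | succ k ih =>
      have hdrop : seqDrop (k * m) (e 0) = e 0 := by
        clear ih
        induction k with
        | zero => rw [zero_mul]; rfl
        | succ k ih => rw [add_mul, one_mul, seqDrop_add, hper _ (he 0), ih]
      rw [add_mul, one_mul, wordOf_add, wordOf_add (e 0), ih, hdrop, ← seqDrop_add,
        show k * m + J * m = (J + k) * m by ring, (hsplit k).1, hconst k]
  refine ⟨J, ?_⟩
  have : seqDrop (J * m) ω = e 0 := seq_ext_wordOf fun n =>
    wordOf_eq_of_le (Nat.le_mul_of_pos_right n hm) (hpref n)
  exact this ▸ he 0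

theorem dimH_range_pt_lt_one (han : ∀ i, AnalyticOn ℝ (S.g i) S.dom) :
    dimH (range S.pt) < 1 := by
  obtain ⟨m, hm, hper⟩ := S.exists_common_period
  obtain ⟨s, hs0, hs1, hs⟩ := S.exists_poincare_le han hm hper
  obtain ⟨M, hM, hcov⟩ := S.exists_frequently_isGood hm fun e he => (hper e he).1
  set G := (words p M).filter S.IsGood with hG
  have hsub : range S.pt ⊆ S.pt '' {ω | ∃ j, seqDrop (j * m) ω ∈ S.badSeqs} ∪
      ⋃ v ∈ (G : Set (List (Fin p))), S.recurrentSet m v := by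
    rintro _ ⟨ω, rfl⟩
    rcases hcov ω with h | h
    · exact Or.inl ⟨ω, h, rfl⟩
    · right
      by_contra hcon
      simp only [mem_iUnion, not_exists, Finset.mem_coe] at hcon
      have hev := (Finset.eventually_all G).2 fun v hv => not_frequently.1 (hcon v hv)
      obtain ⟨j, hj, hj'⟩ := (h.and_eventually hev).exists
      refine hj' _ (Finset.mem_filter.2 ⟨mem_words.2 (length_wordOf _ _), hj⟩)
        ⟨wordOf ω (j * m), mem_words.2 (length_wordOf _ _), ?_⟩
      rw [← wordOf_add]
      exact S.pt_mem _ _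
  refine (dimH_mono hsub).trans_lt ?_
  rw [dimH_union, ((S.countable_setOf_seqDrop_mem_badSeqs m).image _).dimH_zero,
    dimH_bUnion G.countable_toSet, max_lt_iff]
  refine ⟨zero_lt_one, lt_of_le_of_lt (b := (s.toNNReal : ENNReal)) (iSup₂_le fun v hv => ?_) ?_⟩
  · obtain ⟨hvM, hvg⟩ := Finset.mem_filter.1 (Finset.mem_coe.1 hv)
    have hv0 : v ≠ [] := by
      rintro rfl
      exact hM (mem_words.1 hvM).symm
    set ω := seqAppend v fun _ => (⟨0, S.hp⟩ : Fin p)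
    have hω : wordOf ω v.length = v := wordOf_seqAppend_length _ _
    have hbad : ω ∉ S.badSeqs := fun h => h v.length (by simpa using hv0) (by rwa [hω])
    obtain ⟨K, hK⟩ := hs ω hbad
    exact S.dimH_recurrentSet_le hm hv0 hvg hs0 hω hK
  · rw [← ENNReal.coe_one, ENNReal.coe_lt_coe, ← Real.toNNReal_one]
    exact (Real.toNNReal_lt_toNNReal_iff zero_lt_one).2 hs1

end ExpansiveMarkovSystem

/-- If moreover each `g i` is real analytic on its domain, then the Hausdorff
dimension of `Λ_Q` is strictly less than `1`. -/
theorem dimH_limitSet_lt_one {p : ℕ} (S : ExpansiveMarkovSystem p)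
    (han : ∀ i, AnalyticOn ℝ (S.g i) (⋃ j, S.Isub j)) :
    dimH S.limitSet < 1 := by
  exact (dimH_mono S.limitSet_subset_range_pt).trans_lt (S.dimH_range_pt_lt_one han)
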